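/- arXiv:2111.07381 — 2 statements merged into one kernel-verified Lean document; each statement's English description precedes it below -/
import Mathlib

section
/- Non-resonant improvement of the bilinear paraproduct estimate (Proposition 2.6(iii)). Let α₁, α₂, β₁, β₂ ∈ ℝ∖{0} and γ₁, γ₂ ∈ ℝ satisfy γ₁ ≤ min(α₁, β₁, α₁+β₁), γ₂ ≤ min(α₂, β₂) and α₂ + β₂ > 0. Then there is a constant C, depending only on the exponents, such that for all C_b^∞ functions F, G: ℝ² → ℝ and every finite set S of pairs (M,N) of dyadic scales with M ≁ N (i.e. M ≤ 2^{−10}N or N ≤ 2^{−10}M), one has ‖Σ_{(M,N)∈S} P_M^u F · P_N^u G‖_{C_u^{γ₁}C_v^{γ₂}} ≤ C‖F‖_{C_u^{α₁}C_v^{α₂}}‖G‖_{C_u^{β₁}C_v^{β₂}}. -/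
noncomputable section

open Real MeasureTheory
open scoped ENNReal Classical NNReal

/-- A function between real normed spaces is `C_b^∞`: it is smooth and it together with all of
its iterated derivatives is bounded. -/
def CbSmooth {E F : Type*} [NormedAddCommGroup E] [NormedSpace ℝ E]
    [NormedAddCommGroup F] [NormedSpace ℝ F] (f : E → F) : Prop :=
  ContDiff ℝ (⊤ : ℕ∞) f ∧ ∀ n : ℕ, ∃ C : ℝ, ∀ x : E, ‖iteratedFDeriv ℝ n f x‖ ≤ C

/-- An admissible Littlewood–Paley cutoff: a smooth even `[0,1]`-valued function which is `≡ 1`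
on `{|ξ| ≤ 7/8}` and vanishes on `{|ξ| ≥ 9/8}`. -/
structure IsLPCutoff (ρ : ℝ → ℝ) : Prop where
  smooth : ContDiff ℝ (⊤ : ℕ∞) ρ
  nonneg : ∀ ξ, 0 ≤ ρ ξ
  le_one : ∀ ξ, ρ ξ ≤ 1
  even : ∀ ξ, ρ (-ξ) = ρ ξ
  eq_one : ∀ ξ : ℝ, |ξ| ≤ 7 / 8 → ρ ξ = 1
  eq_zero : ∀ ξ : ℝ, 9 / 8 ≤ |ξ| → ρ ξ = 0

/-- The Littlewood–Paley symbol `ρ_N` at the dyadic scale `N = 2 ^ k`. -/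
def lpSymbol (ρ : ℝ → ℝ) : ℕ → ℝ → ℝ
  | 0 => ρ
  | k + 1 => fun ξ => ρ (ξ / 2 ^ (k + 1)) - ρ (2 * ξ / 2 ^ (k + 1))

/-- The inverse Fourier transform `(2π)^{-1/2} ∫ e^{ixξ} g(ξ) dξ` of a real even function,
written as a cosine transform. -/
def invFourier (g : ℝ → ℝ) (x : ℝ) : ℝ :=
  (Real.sqrt (2 * Real.pi))⁻¹ * ∫ ξ : ℝ, Real.cos (x * ξ) * g ξ

/-- The Littlewood–Paley convolution kernel `ρ̌_N`, `N = 2 ^ k`. -/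
def lpKernel (ρ : ℝ → ℝ) (k : ℕ) : ℝ → ℝ :=
  invFourier (lpSymbol ρ k)

/-- The Littlewood–Paley projection `P_N f = ρ̌_N ∗ f`, `N = 2 ^ k`. -/
def LP (ρ : ℝ → ℝ) (k : ℕ) (f : ℝ → ℝ) (x : ℝ) : ℝ :=
  ∫ y : ℝ, lpKernel ρ k y * f (x - y)

/-- The Littlewood–Paley projection in the first variable. -/
def LPu (ρ : ℝ → ℝ) (k : ℕ) (F : ℝ × ℝ → ℝ) (p : ℝ × ℝ) : ℝ :=
  ∫ y : ℝ, lpKernel ρ k y * F (p.1 - y, p.2)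

/-- The Littlewood–Paley projection in the second variable. -/
def LPv (ρ : ℝ → ℝ) (k : ℕ) (F : ℝ × ℝ → ℝ) (p : ℝ × ℝ) : ℝ :=
  ∫ y : ℝ, lpKernel ρ k y * F (p.1, p.2 - y)

/-- The Hölder norm `‖f‖_{C^γ} = sup_N N^γ ‖P_N f‖_{L^∞}`, valued in `[0,∞]`. -/
def hNorm (ρ : ℝ → ℝ) (γ : ℝ) (f : ℝ → ℝ) : ℝ≥0∞ :=
  ⨆ k : ℕ, ENNReal.ofReal (((2 : ℝ) ^ k) ^ γ) * ⨆ x : ℝ, ENNReal.ofReal |LP ρ k f x|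

/-- The product Hölder norm `‖F‖_{C_u^{γ₁} C_v^{γ₂}}`, valued in `[0,∞]`. -/
def hNorm2 (ρ : ℝ → ℝ) (γ₁ γ₂ : ℝ) (F : ℝ × ℝ → ℝ) : ℝ≥0∞ :=
  ⨆ k₁ : ℕ, ⨆ k₂ : ℕ,
    ENNReal.ofReal (((2 : ℝ) ^ k₁) ^ γ₁ * ((2 : ℝ) ^ k₂) ^ γ₂) *
      ⨆ p : ℝ × ℝ, ENNReal.ofReal |LPu ρ k₁ (LPv ρ k₂ F) p|

/-- `2 ^ k₁ ∼ 2 ^ k₂`: comparable dyadic scales. -/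
def DClose (k₁ k₂ : ℕ) : Prop :=
  (2 : ℝ) ^ k₂ / 2 ^ 10 < (2 : ℝ) ^ k₁ ∧ (2 : ℝ) ^ k₁ < 2 ^ 10 * (2 : ℝ) ^ k₂

/-- `2 ^ k₁ ≪ 2 ^ k₂`. -/
def DLow (k₁ k₂ : ℕ) : Prop := (2 : ℝ) ^ k₁ ≤ (2 : ℝ) ^ k₂ / 2 ^ 10

/-- `2 ^ k₁ ≳ 2 ^ k₂`. -/
def DGtr (k₁ k₂ : ℕ) : Prop := (2 : ℝ) ^ k₂ ≤ 2 ^ 10 * (2 : ℝ) ^ k₁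

open scoped FourierTransform SchwartzMap in
/-- An even smooth compactly supported symbol, as a complex Schwartz function. -/
lemma exists_schwartz (g : ℝ → ℝ) (hg : ContDiff ℝ (⊤ : ℕ∞) g) (hc : HasCompactSupport g) :
    ∃ f : 𝓢(ℝ, ℂ), ∀ x, f x = (g x : ℂ) := by
  have h1 : HasCompactSupport (fun x => (g x : ℂ)) := hc.comp_left (g := fun t : ℝ => (t : ℂ)) (by simp)
  have h2 : ContDiff ℝ (⊤ : ℕ∞) (fun x => (g x : ℂ)) := Complex.ofRealCLM.contDiff.comp hg
  exact ⟨h1.toSchwartzMap h2, fun x => rfl⟩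

open scoped FourierTransform SchwartzMap in
lemma invFourier_eq (g : ℝ → ℝ) (hi : Integrable g) (he : ∀ x, g (-x) = g x) (x : ℝ) :
    ((invFourier g x : ℝ) : ℂ) =
      ((Real.sqrt (2 * π))⁻¹ : ℝ) * 𝓕⁻ (fun ξ => (g ξ : ℂ)) (x / (2 * π)) := by
  rw [Real.fourierInv_eq']
  unfold invFourier
  rw [Complex.ofReal_mul]
  congr 1
  have hcos : Integrable (fun ξ => Real.cos (x * ξ) * g ξ) :=
    hi.bdd_mul (c := 1) (by fun_prop) (by filter_upwards with ξ using by simpa using Real.abs_cos_le_one _)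
  have hsin : Integrable (fun ξ => Real.sin (x * ξ) * g ξ) :=
    hi.bdd_mul (c := 1) (by fun_prop) (by filter_upwards with ξ using by simpa using Real.abs_sin_le_one _)
  have hs0 : ∫ ξ, Real.sin (x * ξ) * g ξ = 0 := by
    have := integral_neg_eq_self (fun ξ => Real.sin (x * ξ) * g ξ) volume
    simp only [mul_neg, Real.sin_neg, he, neg_mul, integral_neg] at this
    linarith
  have key : (fun v : ℝ => Complex.exp (((2 * π * inner ℝ v (x / (2 * π)) : ℝ) : ℂ) * Complex.I) • (g v : ℂ))
      = fun v => ((Real.cos (x * v) * g v : ℝ) : ℂ) + ((Real.sin (x * v) * g v : ℝ) : ℂ) * Complex.I := by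
    funext v
    have : 2 * π * inner ℝ v (x / (2 * π)) = x * v := by
      simp; field_simp
    rw [this, Complex.exp_mul_I, smul_eq_mul]
    push_cast
    ring
  rw [key, integral_add hcos.ofReal (hsin.ofReal.mul_const _), integral_mul_const, integral_complex_ofReal,
    integral_complex_ofReal, hs0]
  simp

open scoped FourierTransform SchwartzMap in
lemma invFourier_props (g : ℝ → ℝ) (hg : ContDiff ℝ (⊤ : ℕ∞) g) (hc : HasCompactSupport g)
    (he : ∀ x, g (-x) = g x) :
    Continuous (invFourier g) ∧ Integrable (invFourier g) ∧
    ∀ a ζ : ℝ, ∫ w, invFourier g w * Real.cos (a - w * ζ) = Real.sqrt (2 * π) * g ζ * Real.cos a := by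
  obtain ⟨f, hf⟩ := exists_schwartz g hg hc
  have hi : Integrable g := hg.continuous.integrable_of_hasCompactSupport hc
  have hff : (fun ξ => (g ξ : ℂ)) = f := by funext x; rw [hf]
  have e : ∀ x, ((invFourier g x : ℝ) : ℂ) = ((Real.sqrt (2 * π))⁻¹ : ℝ) * (𝓕⁻ f) (x / (2 * π)) := by
    intro x
    rw [invFourier_eq g hi he, hff, SchwartzMap.fourierInv_coe]
  have hcC : Continuous (fun x => ((invFourier g x : ℝ) : ℂ)) := by
    simp_rw [e]
    exact continuous_const.mul ((𝓕⁻ f).continuous.comp (by fun_prop))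
  have hiC : Integrable (fun x => ((invFourier g x : ℝ) : ℂ)) := by
    simp_rw [e]
    exact ((𝓕⁻ f).integrable.comp_div (by positivity)).const_mul _
  have hcR : Continuous (invFourier g) := by
    exact Complex.continuous_re.comp hcC
  have hiR : Integrable (invFourier g) := by
    simpa using hiC.re
  refine ⟨hcR, hiR, fun a ζ => ?_⟩
  have hinv : ∫ w, ((invFourier g w : ℝ) : ℂ) * Complex.exp (-(w * ζ : ℝ) * Complex.I)
      = ((Real.sqrt (2 * π) * g ζ : ℝ) : ℂ) := by
    have h0 : 𝓕 (𝓕⁻ f) ζ = f ζ := by rw [FourierTransform.fourier_fourierInv_eq]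
    rw [SchwartzMap.fourier_coe, Real.fourier_eq'] at h0
    have h1 := Measure.integral_comp_div (fun v : ℝ => Complex.exp (((-2 * π * inner ℝ v ζ : ℝ) : ℂ) * Complex.I) • (𝓕⁻ f) v) (2 * π)
    rw [h0, hf] at h1
    have h2 : (fun w : ℝ => ((invFourier g w : ℝ) : ℂ) * Complex.exp (-(w * ζ : ℝ) * Complex.I)) =
      fun w : ℝ => (((Real.sqrt (2 * π))⁻¹ : ℝ) : ℂ) * (Complex.exp (((-2 * π * inner ℝ (w / (2 * π)) ζ : ℝ) : ℂ) * Complex.I) • (𝓕⁻ f) (w / (2 * π))) := by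
      funext w
      rw [e]
      have : -2 * π * inner ℝ (w / (2 * π)) ζ = - (w * ζ) := by
        simp; field_simp
      rw [this, smul_eq_mul]
      push_cast
      ring
    rw [h2, integral_const_mul, h1]
    have hs : (Real.sqrt (2 * π))⁻¹ * |2 * π| = Real.sqrt (2 * π) := by
      rw [abs_of_pos (by positivity)]
      have : 0 < 2 * π := by positivity
      rw [inv_mul_eq_div, Real.div_sqrt]
    rw [Complex.real_smul, ← mul_assoc, ← Complex.ofReal_mul, hs]
    push_cast; ring
  have h3 : ∀ w : ℝ, invFourier g w * Real.cos (a - w * ζ) =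
      RCLike.re (Complex.exp (a * Complex.I) * (((invFourier g w : ℝ) : ℂ) * Complex.exp (-(w * ζ : ℝ) * Complex.I))) := by
    intro w
    have : Complex.exp (a * Complex.I) * (((invFourier g w : ℝ) : ℂ) * Complex.exp (-(w * ζ : ℝ) * Complex.I))
       = ((invFourier g w : ℝ) : ℂ) * Complex.exp ((a - w * ζ : ℝ) * Complex.I) := by
      rw [mul_left_comm, ← Complex.exp_add]; congr 2; push_cast; ring
    rw [this]
    rw [RCLike.re_to_complex, Complex.re_ofReal_mul, Complex.exp_ofReal_mul_I_re]
  have hint : Integrable (fun w : ℝ => Complex.exp (a * Complex.I) * (((invFourier g w : ℝ) : ℂ) * Complex.exp (-(w * ζ : ℝ) * Complex.I))) := by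
    apply Integrable.const_mul
    refine hiC.mul_bdd (c := 1) (by fun_prop) ?_
    filter_upwards with w
    have := Complex.norm_exp_ofReal_mul_I (-(w * ζ))
    push_cast at this ⊢
    rw [this]
  simp_rw [h3]
  rw [integral_re hint, integral_const_mul, hinv]
  simp only [RCLike.re_to_complex, Complex.re_mul_ofReal, Complex.exp_ofReal_mul_I_re]
  ring

lemma cutoff_hcs {ρ : ℝ → ℝ} (hρ : IsLPCutoff ρ) : HasCompactSupport ρ := by
  apply HasCompactSupport.of_support_subset_isCompact (isCompact_Icc (a := (-(9/8) : ℝ)) (b := 9/8))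
  intro x hx
  rw [Function.mem_support] at hx
  by_contra h
  apply hx
  apply hρ.eq_zero
  rw [Set.mem_Icc, ← abs_le] at h
  exact le_of_lt (not_le.mp h)

/-- The mother symbol `ρ(ξ) - ρ(2ξ)`. -/
def psiSymbol (ρ : ℝ → ℝ) : ℝ → ℝ := fun ξ => ρ ξ - ρ (2 * ξ)

lemma psi_props {ρ : ℝ → ℝ} (hρ : IsLPCutoff ρ) :
    ContDiff ℝ (⊤ : ℕ∞) (psiSymbol ρ) ∧ HasCompactSupport (psiSymbol ρ) ∧
      ∀ x, psiSymbol ρ (-x) = psiSymbol ρ x := by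
  refine ⟨?_, ?_, ?_⟩
  · exact hρ.smooth.sub (hρ.smooth.comp (by fun_prop))
  · apply HasCompactSupport.of_support_subset_isCompact (isCompact_Icc (a := (-(9/8) : ℝ)) (b := 9/8))
    intro x hx
    rw [Function.mem_support] at hx
    by_contra h
    apply hx
    rw [Set.mem_Icc, ← abs_le, not_le] at h
    rw [psiSymbol, hρ.eq_zero x h.le, hρ.eq_zero (2 * x) (by rw [abs_mul, abs_two]; linarith), sub_self]
  · intro x
    simp only [psiSymbol, mul_neg, hρ.even]

lemma lpSymbol_succ (ρ : ℝ → ℝ) (k : ℕ) :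
    lpSymbol ρ (k + 1) = fun ξ => psiSymbol ρ (ξ / 2 ^ (k + 1)) := by
  funext ξ
  simp only [lpSymbol, psiSymbol, mul_div_assoc]

lemma dilate_props {g : ℝ → ℝ} (hg : ContDiff ℝ (⊤ : ℕ∞) g) (hc : HasCompactSupport g)
    (he : ∀ x, g (-x) = g x) (s : ℝ) (hs : 0 < s) :
    ContDiff ℝ (⊤ : ℕ∞) (fun ξ => g (ξ / s)) ∧ HasCompactSupport (fun ξ => g (ξ / s)) ∧
      ∀ x, g (-x / s) = g (x / s) := by
  refine ⟨hg.comp (by fun_prop), ?_, fun x => by rw [neg_div, he]⟩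
  have := hc.comp_homeomorph (Homeomorph.mulRight₀ s⁻¹ (by positivity))
  simpa [Function.comp_def, div_eq_mul_inv] using this

lemma lpSymbol_props {ρ : ℝ → ℝ} (hρ : IsLPCutoff ρ) (k : ℕ) :
    ContDiff ℝ (⊤ : ℕ∞) (lpSymbol ρ k) ∧ HasCompactSupport (lpSymbol ρ k) ∧
      ∀ x, lpSymbol ρ k (-x) = lpSymbol ρ k x := by
  cases k with
  | zero => exact ⟨hρ.smooth, cutoff_hcs hρ, hρ.even⟩
  | succ k =>
    rw [lpSymbol_succ]
    obtain ⟨h1, h2, h3⟩ := psi_props hρ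
    exact dilate_props h1 h2 h3 _ (by positivity)

lemma lpSymbol_upper {ρ : ℝ → ℝ} (hρ : IsLPCutoff ρ) (k : ℕ) (ξ : ℝ) (h : lpSymbol ρ k ξ ≠ 0) :
    |ξ| < 9 / 8 * 2 ^ k := by
  by_contra hc
  rw [not_lt] at hc
  apply h
  cases k with
  | zero => exact hρ.eq_zero _ (by simpa using hc)
  | succ k =>
    have hp : (0:ℝ) < 2 ^ (k+1) := by positivity
    have h1 : 9 / 8 ≤ |ξ / 2 ^ (k+1)| := by
      rw [abs_div, abs_of_pos hp, le_div_iff₀ hp]; exact hc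
    rw [lpSymbol_succ]
    simp only [psiSymbol]
    rw [hρ.eq_zero _ h1, hρ.eq_zero _ (by rw [abs_mul, abs_two]; linarith), sub_self]

lemma lpSymbol_lower {ρ : ℝ → ℝ} (hρ : IsLPCutoff ρ) (k : ℕ) (ξ : ℝ)
    (h : lpSymbol ρ (k + 1) ξ ≠ 0) :
    7 / 16 * 2 ^ (k + 1) < |ξ| := by
  by_contra hc
  rw [not_lt] at hc
  apply h
  have hp : (0:ℝ) < 2 ^ (k+1) := by positivity
  have h1 : |ξ / 2 ^ (k+1)| ≤ 7 / 16 := by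
    rw [abs_div, abs_of_pos hp, div_le_iff₀ hp]; exact hc
  rw [lpSymbol_succ]
  simp only [psiSymbol]
  rw [hρ.eq_one _ (by linarith), hρ.eq_one _ (by rw [abs_mul, abs_two]; linarith), sub_self]

/-- Frequency compatibility of three scales. -/
def Compat (a b l : ℕ) : Prop :=
  l ≤ max a b + 2 ∧ a ≤ max b l + 2 ∧ b ≤ max a l + 2

lemma scale_le {ρ : ℝ → ℝ} (hρ : IsLPCutoff ρ) (a b c : ℕ) (x y z : ℝ) (hx : |x| ≤ |y| + |z|)
    (ha : lpSymbol ρ a x ≠ 0) (hb : lpSymbol ρ b y ≠ 0) (hc : lpSymbol ρ c z ≠ 0) :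
    a ≤ max b c + 2 := by
  cases a with
  | zero => omega
  | succ a =>
    have h1 := lpSymbol_lower hρ a x ha
    have h2 := lpSymbol_upper hρ b y hb
    have h3 := lpSymbol_upper hρ c z hc
    by_contra hh
    rw [not_le] at hh
    have e1 : (2:ℝ) ^ b ≤ 2 ^ (max b c) := pow_le_pow_right₀ (by norm_num) (le_max_left _ _)
    have e2 : (2:ℝ) ^ c ≤ 2 ^ (max b c) := pow_le_pow_right₀ (by norm_num) (le_max_right _ _)
    have e3 : (2:ℝ) ^ (max b c + 3) ≤ 2 ^ (a + 1) := pow_le_pow_right₀ (by norm_num) hh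
    have e4 : (2:ℝ) ^ (max b c + 3) = 8 * 2 ^ (max b c) := by ring
    have e5 : (0:ℝ) < 2 ^ (max b c) := by positivity
    linarith

lemma symbol_prod_zero {ρ : ℝ → ℝ} (hρ : IsLPCutoff ρ) (a b l : ℕ) (h : ¬ Compat a b l) (x y : ℝ) :
    lpSymbol ρ a x * lpSymbol ρ b y * lpSymbol ρ l (x + y) = 0 := by
  by_contra hne
  simp only [mul_eq_zero, not_or] at hne
  obtain ⟨⟨ha, hb⟩, hl⟩ := hne
  apply h
  refine ⟨scale_le hρ l a b (x + y) x y (abs_add_le x y) hl ha hb,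
    scale_le hρ a b l x y (x + y) ?_ ha hb hl, scale_le hρ b a l y x (x + y) ?_ hb ha hl⟩
  · have := abs_sub (x + y) y
    simp only [add_sub_cancel_right] at this; linarith
  · have := abs_sub (x + y) x
    simp only [add_sub_cancel_left] at this; linarith

lemma invFourier_dilate (g : ℝ → ℝ) (s : ℝ) (hs : 0 < s) (x : ℝ) :
    invFourier (fun ξ => g (ξ / s)) x = s * invFourier g (s * x) := by
  unfold invFourier
  have := Measure.integral_comp_div (fun ξ => Real.cos (s * x * ξ) * g ξ) s
  rw [abs_of_pos hs, smul_eq_mul] at this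
  have h2 : ∀ ξ, Real.cos (x * ξ) * g (ξ / s) = Real.cos (s * x * (ξ / s)) * g (ξ / s) := by
    intro ξ; congr 2; field_simp
  simp_rw [h2]
  rw [this]; ring

lemma integral_abs_dilate (φ : ℝ → ℝ) (s : ℝ) (hs : 0 < s) :
    ∫ x, |s * φ (s * x)| = ∫ x, |φ x| := by
  simp_rw [abs_mul, integral_const_mul]
  rw [Measure.integral_comp_mul_left (fun x => |φ x|) s, abs_of_pos hs, abs_of_pos (by positivity), smul_eq_mul]
  field_simp

lemma lpKernel_props {ρ : ℝ → ℝ} (hρ : IsLPCutoff ρ) (k : ℕ) :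
    Continuous (lpKernel ρ k) ∧ Integrable (lpKernel ρ k) ∧
    ∀ a ζ : ℝ, ∫ w, lpKernel ρ k w * Real.cos (a - w * ζ)
      = Real.sqrt (2 * π) * lpSymbol ρ k ζ * Real.cos a := by
  obtain ⟨h1, h2, h3⟩ := lpSymbol_props hρ k
  exact invFourier_props _ h1 h2 h3

lemma lpKernel_L1 (ρ : ℝ → ℝ) :
    ∃ K : ℝ, 0 ≤ K ∧ ∀ k, ∫ x, |lpKernel ρ k x| ≤ K := by
  refine ⟨max (∫ x, |invFourier ρ x|) (∫ x, |invFourier (psiSymbol ρ) x|),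
    le_max_of_le_left (integral_nonneg fun _ => abs_nonneg _), fun k => ?_⟩
  cases k with
  | zero => exact le_max_left _ _
  | succ k =>
    apply le_max_of_le_right
    unfold lpKernel
    rw [lpSymbol_succ]
    simp_rw [invFourier_dilate (psiSymbol ρ) (2 ^ (k+1)) (by positivity)]
    rw [integral_abs_dilate _ _ (by positivity)]

lemma lpSymbol_sum (ρ : ℝ → ℝ) (n : ℕ) (ξ : ℝ) :
    ∑ k ∈ Finset.range (n + 1), lpSymbol ρ k ξ = ρ (ξ / 2 ^ n) := by
  induction n with
  | zero => simp [lpSymbol]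
  | succ n ih =>
    rw [Finset.sum_range_succ, ih]
    simp only [lpSymbol]
    have : 2 * ξ / 2 ^ (n + 1) = ξ / 2 ^ n := by rw [pow_succ]; field_simp
    rw [this]; ring

lemma lpKernel_sum {ρ : ℝ → ℝ} (hρ : IsLPCutoff ρ) (n : ℕ) (x : ℝ) :
    ∑ k ∈ Finset.range (n + 1), lpKernel ρ k x = 2 ^ n * invFourier ρ (2 ^ n * x) := by
  rw [← invFourier_dilate ρ (2 ^ n) (by positivity)]
  simp_rw [← lpSymbol_sum]
  unfold lpKernel invFourier
  rw [← Finset.mul_sum]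
  congr 1
  rw [← integral_finsetSum]
  · simp_rw [Finset.mul_sum]
  · intro k _
    obtain ⟨h1, h2, h3⟩ := lpSymbol_props hρ k
    exact (h1.continuous.integrable_of_hasCompactSupport h2).bdd_mul (c := 1) (by fun_prop)
      (by filter_upwards with ξ using by simpa using Real.abs_cos_le_one _)

/-- Bounded continuous functions. -/
def BC {X : Type*} [TopologicalSpace X] (f : X → ℝ) : Prop :=
  Continuous f ∧ ∃ B : ℝ, 0 ≤ B ∧ ∀ x, |f x| ≤ B

lemma BC.integrable_mul {φ f : ℝ → ℝ} (hφ : Integrable φ) (hf : BC f) : Integrable (fun y => φ y * f y) := by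
  obtain ⟨hc, B, hB, hb⟩ := hf
  exact hφ.mul_bdd (c := B) (by fun_prop) (by filter_upwards with x using by simpa using hb x)

lemma BC.comp {X Y : Type*} [TopologicalSpace X] [TopologicalSpace Y] {f : Y → ℝ} (hf : BC f) {g : X → Y}
    (hg : Continuous g) : BC (fun x => f (g x)) := by
  obtain ⟨hc, B, hB, hb⟩ := hf
  exact ⟨hc.comp hg, B, hB, fun x => hb _⟩

lemma BC.mul {X : Type*} [TopologicalSpace X] {f g : X → ℝ} (hf : BC f) (hg : BC g) :
    BC (fun x => f x * g x) := by
  obtain ⟨hc, B, hB, hb⟩ := hf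
  obtain ⟨hc', B', hB', hb'⟩ := hg
  refine ⟨hc.mul hc', B * B', by positivity, fun x => ?_⟩
  rw [abs_mul]
  exact mul_le_mul (hb x) (hb' x) (abs_nonneg _) hB

lemma BC.sum {X ι : Type*} [TopologicalSpace X] {f : ι → X → ℝ} (s : Finset ι) (hf : ∀ i ∈ s, BC (f i)) :
    BC (fun x => ∑ i ∈ s, f i x) := by
  choose! hc B hB hb using hf
  refine ⟨continuous_finsetSum _ hc, ∑ i ∈ s, B i, Finset.sum_nonneg hB, fun x => ?_⟩
  exact (Finset.abs_sum_le_sum_abs _ _).trans (Finset.sum_le_sum fun i hi => hb i hi x)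

lemma abs_conv_le {φ f : ℝ → ℝ} (hφ : Integrable φ) (B K : ℝ) (hB : 0 ≤ B)
    (hK : ∫ x, |φ x| ≤ K) (hb : ∀ x, |f x| ≤ B) : |∫ y, φ y * f y| ≤ K * B := by
  calc |∫ y, φ y * f y| ≤ ∫ y, |φ y| * B := by
        rw [← Real.norm_eq_abs]
        refine norm_integral_le_of_norm_le (hφ.abs.mul_const B) ?_
        filter_upwards with y
        rw [Real.norm_eq_abs, abs_mul]
        exact mul_le_mul_of_nonneg_left (hb y) (abs_nonneg _)
    _ = (∫ y, |φ y|) * B := integral_mul_const _ _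
    _ ≤ K * B := mul_le_mul_of_nonneg_right hK hB

/-- Convolution in a parameter keeps bounded continuous functions bounded continuous. -/
lemma BC.conv {X : Type*} [TopologicalSpace X] [FirstCountableTopology X] {φ : ℝ → ℝ} (hφc : Continuous φ)
    (hφ : Integrable φ) {H : X → ℝ → ℝ} (hH : BC (fun q : X × ℝ => H q.1 q.2)) :
    BC (fun x => ∫ y, φ y * H x y) := by
  obtain ⟨hc, B, hB, hb⟩ := hH
  refine ⟨?_, (∫ x, |φ x|) * B, mul_nonneg (integral_nonneg fun _ => abs_nonneg _) hB, fun x =>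
    abs_conv_le hφ B _ hB le_rfl fun y => hb (x, y)⟩
  refine continuous_of_dominated (bound := fun y => |φ y| * B) ?_ ?_ (hφ.abs.mul_const B) ?_
  · intro x
    have : Continuous (fun y => H x y) := hc.comp (Continuous.prodMk_right x)
    exact (hφc.mul this).aestronglyMeasurable
  · intro x
    filter_upwards with y
    rw [Real.norm_eq_abs, abs_mul]
    exact mul_le_mul_of_nonneg_left (hb (x, y)) (abs_nonneg _)
  · filter_upwards with y
    have : Continuous (fun x => H x y) := hc.comp (Continuous.prodMk_left y)
    exact continuous_const.mul this

lemma LP_BC {ρ : ℝ → ℝ} (hρ : IsLPCutoff ρ) (k : ℕ) {f : ℝ → ℝ} (hf : BC f) : BC (LP ρ k f) := by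
  obtain ⟨h1, h2, -⟩ := lpKernel_props hρ k
  exact BC.conv h1 h2 (H := fun x y => f (x - y)) (hf.comp (g := fun q : ℝ × ℝ => q.1 - q.2) (by fun_prop))

lemma LP_sum_eq {ρ : ℝ → ℝ} (hρ : IsLPCutoff ρ) (n : ℕ) {f : ℝ → ℝ} (hf : BC f) (x : ℝ) :
    ∑ k ∈ Finset.range (n + 1), LP ρ k f x = ∫ y, invFourier ρ y * f (x - y / 2 ^ n) := by
  unfold LP
  rw [← integral_finsetSum]
  · simp_rw [← Finset.sum_mul, lpKernel_sum hρ]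
    have := Measure.integral_comp_mul_left (fun y => invFourier ρ y * f (x - y / 2 ^ n)) (2 ^ n)
    have e : ∀ y : ℝ, 2 ^ n * y / 2 ^ n = y := fun y => by field_simp
    simp_rw [e] at this
    simp_rw [mul_assoc, integral_const_mul]
    rw [this, abs_of_pos (by positivity), smul_eq_mul]
    field_simp
  · intro k _
    exact (hf.comp (g := fun y => x - y) (by fun_prop)).integrable_mul (lpKernel_props hρ k).2.1

lemma LP_sum_bound {ρ : ℝ → ℝ} (hρ : IsLPCutoff ρ) {f : ℝ → ℝ} (hf : BC f) :
    ∃ B, 0 ≤ B ∧ ∀ n x, |∑ k ∈ Finset.range (n + 1), LP ρ k f x| ≤ B := by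
  obtain ⟨hc, B, hB, hb⟩ := id hf
  refine ⟨(∫ x, |invFourier ρ x|) * B, mul_nonneg (integral_nonneg fun _ => abs_nonneg _) hB, fun n x => ?_⟩
  rw [LP_sum_eq hρ n hf]
  exact abs_conv_le (lpKernel_props hρ 0).2.1 B _ hB le_rfl fun y => hb _

lemma LP_sum_tendsto {ρ : ℝ → ℝ} (hρ : IsLPCutoff ρ) {f : ℝ → ℝ} (hf : BC f) (x : ℝ) :
    Filter.Tendsto (fun n => ∑ k ∈ Finset.range (n + 1), LP ρ k f x) Filter.atTop
      (nhds (Real.sqrt (2 * π) * f x)) := by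
  obtain ⟨hc, B, hB, hb⟩ := id hf
  obtain ⟨h1, h2, h3⟩ := lpKernel_props hρ 0
  have h0 : ∫ y, invFourier ρ y * f x = Real.sqrt (2 * π) * f x := by
    have := h3 0 0
    simp only [mul_zero, sub_zero, Real.cos_zero, mul_one] at this
    rw [integral_mul_const]
    congr 1
    have e : lpSymbol ρ 0 0 = 1 := hρ.eq_one 0 (by norm_num)
    rw [e, mul_one] at this
    exact this
  simp_rw [LP_sum_eq hρ _ hf]
  rw [← h0]
  refine tendsto_integral_of_dominated_convergence (fun y => |invFourier ρ y| * B) ?_ (h2.abs.mul_const B) ?_ ?_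
  · intro n
    have h1' : Continuous (invFourier ρ) := h1
    exact (h1'.mul (hc.comp (by fun_prop))).aestronglyMeasurable
  · intro n
    filter_upwards with y
    rw [Real.norm_eq_abs, abs_mul]
    exact mul_le_mul_of_nonneg_left (hb _) (abs_nonneg _)
  · filter_upwards with y
    apply Filter.Tendsto.const_mul
    apply (hc.tendsto x).comp
    have : Filter.Tendsto (fun n : ℕ => x - y * (1/2 : ℝ) ^ n) Filter.atTop (nhds (x - y * 0)) :=
      ((tendsto_pow_atTop_nhds_zero_of_lt_one (by norm_num) (by norm_num)).const_mul y).const_sub x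
    simpa [div_eq_mul_inv] using this

lemma kernel_tri {ρ : ℝ → ℝ} (hρ : IsLPCutoff ρ) (a b l : ℕ) (h : ¬ Compat a b l) (s t : ℝ) :
    ∫ w, lpKernel ρ l w * (lpKernel ρ a (s - w) * lpKernel ρ b (t - w)) = 0 := by
  obtain ⟨hlc, hli, hlinv⟩ := lpKernel_props hρ l
  obtain ⟨ha1, ha2, -⟩ := lpSymbol_props hρ a
  obtain ⟨hb1, hb2, hb3⟩ := lpSymbol_props hρ b
  have hac := ha1.continuous
  have hbc := hb1.continuous
  have hai := hac.integrable_of_hasCompactSupport (μ := volume) ha2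
  have hbi := hbc.integrable_of_hasCompactSupport (μ := volume) hb2
  have e1 : ∀ w, lpKernel ρ l w * (lpKernel ρ a (s - w) * lpKernel ρ b (t - w)) =
      (Real.sqrt (2 * π))⁻¹ ^ 2 * ∫ z : ℝ × ℝ, lpKernel ρ l w *
        (Real.cos ((s - w) * z.1) * Real.cos ((t - w) * z.2)) * (lpSymbol ρ a z.1 * lpSymbol ρ b z.2) := by
    intro w
    have := integral_prod_mul (μ := (volume : Measure ℝ)) (ν := (volume : Measure ℝ))
      (fun x => Real.cos ((s - w) * x) * lpSymbol ρ a x) (fun x => Real.cos ((t - w) * x) * lpSymbol ρ b x)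
    have e : ∀ z : ℝ × ℝ, lpKernel ρ l w *
        (Real.cos ((s - w) * z.1) * Real.cos ((t - w) * z.2)) * (lpSymbol ρ a z.1 * lpSymbol ρ b z.2)
        = lpKernel ρ l w * ((Real.cos ((s - w) * z.1) * lpSymbol ρ a z.1) *
          (Real.cos ((t - w) * z.2) * lpSymbol ρ b z.2)) := fun z => by ring
    simp_rw [e]
    rw [integral_const_mul, Measure.volume_eq_prod, this]
    unfold lpKernel
    unfold invFourier
    ring
  simp_rw [e1]
  rw [integral_const_mul]
  have hint : Integrable (Function.uncurry fun (w : ℝ) (z : ℝ × ℝ) => lpKernel ρ l w *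
        (Real.cos ((s - w) * z.1) * Real.cos ((t - w) * z.2)) * (lpSymbol ρ a z.1 * lpSymbol ρ b z.2))
        (volume.prod volume) := by
    have i1 : Integrable (fun z : ℝ × ℝ => lpSymbol ρ a z.1 * lpSymbol ρ b z.2) := hai.mul_prod hbi
    have i2 : Integrable (fun q : ℝ × (ℝ × ℝ) => lpKernel ρ l q.1 * (lpSymbol ρ a q.2.1 * lpSymbol ρ b q.2.2))
      (volume.prod volume) := hli.mul_prod i1
    have i3 := i2.bdd_mul (c := 1) (f := fun q : ℝ × (ℝ × ℝ) =>
      (Real.cos ((s - q.1) * q.2.1) * Real.cos ((t - q.1) * q.2.2))) (by fun_prop) (by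
        filter_upwards with q
        rw [Real.norm_eq_abs, abs_mul]
        exact mul_le_one₀ (Real.abs_cos_le_one _) (abs_nonneg _) (Real.abs_cos_le_one _))
    refine i3.congr (Filter.Eventually.of_forall fun q => ?_)
    simp only [Function.uncurry]
    ring
  rw [integral_integral_swap hint]
  have e2 : ∀ z : ℝ × ℝ, ∫ w, lpKernel ρ l w *
        (Real.cos ((s - w) * z.1) * Real.cos ((t - w) * z.2)) * (lpSymbol ρ a z.1 * lpSymbol ρ b z.2) = 0 := by
    rintro ⟨x, y⟩
    simp only
    rw [integral_mul_const]
    have hcc : ∀ w : ℝ, lpKernel ρ l w * (Real.cos ((s - w) * x) * Real.cos ((t - w) * y)) =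
      2⁻¹ * (lpKernel ρ l w * Real.cos ((s * x + t * y) - w * (x + y)) +
        lpKernel ρ l w * Real.cos ((s * x - t * y) - w * (x + -y))) := by
      intro w
      have h1 : (s * x + t * y) - w * (x + y) = (s - w) * x + (t - w) * y := by ring
      have h2 : (s * x - t * y) - w * (x + -y) = (s - w) * x - (t - w) * y := by ring
      rw [h1, h2, Real.cos_add, Real.cos_sub]
      ring
    simp_rw [hcc]
    have ii : ∀ c ζ : ℝ, Integrable (fun w => lpKernel ρ l w * Real.cos (c - w * ζ)) := fun c ζ =>
      hli.mul_bdd (c := 1) (by fun_prop) (by filter_upwards with ξ using by simpa using Real.abs_cos_le_one _)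
    rw [integral_const_mul, integral_add (ii _ _) (ii _ _), hlinv, hlinv]
    have z1 := symbol_prod_zero hρ a b l h x y
    have z2 := symbol_prod_zero hρ a b l h x (-y)
    rw [hb3] at z2
    linear_combination (2⁻¹ * Real.sqrt (2 * π) * Real.cos (s * x + t * y)) * z1 +
      (2⁻¹ * Real.sqrt (2 * π) * Real.cos (s * x - t * y)) * z2
  simp_rw [e2]
  simp

lemma LP_eq_swap (ρ : ℝ → ℝ) (k : ℕ) (f : ℝ → ℝ) (x : ℝ) :
    LP ρ k f x = ∫ y, lpKernel ρ k (x - y) * f y := by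
  unfold LP
  rw [← integral_sub_left_eq_self _ volume x]
  simp

/-- Frequency support: incompatible scales give a vanishing projection of the product. -/
lemma LP_tri_zero {ρ : ℝ → ℝ} (hρ : IsLPCutoff ρ) (a b l : ℕ) (h : ¬ Compat a b l) {f g : ℝ → ℝ}
    (hf : BC f) (hg : BC g) (x : ℝ) : LP ρ l (fun t => LP ρ a f t * LP ρ b g t) x = 0 := by
  obtain ⟨hlc, hli, -⟩ := lpKernel_props hρ l
  obtain ⟨hac, hai, -⟩ := lpKernel_props hρ a
  obtain ⟨hbc, hbi, -⟩ := lpKernel_props hρ b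
  obtain ⟨hfc, Bf, hBf, hbf⟩ := hf
  obtain ⟨hgc, Bg, hBg, hbg⟩ := hg
  obtain ⟨K, hK, hKb⟩ := lpKernel_L1 ρ
  have i0 : ∀ (k : ℕ) (f : ℝ → ℝ) (B : ℝ), Continuous f → (∀ x, |f x| ≤ B) → ∀ c,
      Integrable (fun y => lpKernel ρ k (c - y) * f y) := fun k f B hc hb c =>
    (((lpKernel_props hρ k).2.1.comp_sub_left c).mul_bdd (c := B) hc.aestronglyMeasurable
      (by filter_upwards with y using by simpa using hb y))
  have ib : ∀ (k : ℕ) (f : ℝ → ℝ) (B : ℝ), 0 ≤ B → (∀ x, |f x| ≤ B) → ∀ c,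
      ∫ y, |lpKernel ρ k (c - y) * f y| ≤ K * B := by
    intro k f B hB hb c
    have : ∫ y, |lpKernel ρ k (c - y)| * B ≤ K * B := by
      rw [integral_mul_const, integral_sub_left_eq_self (fun y => |lpKernel ρ k y|) volume c]
      exact mul_le_mul_of_nonneg_right (hKb k) hB
    refine le_trans (integral_mono_of_nonneg (Filter.Eventually.of_forall fun _ => abs_nonneg _)
      ((((lpKernel_props hρ k).2.1.comp_sub_left c).abs).mul_const B) (Filter.Eventually.of_forall fun y => ?_)) this
    simp only [abs_mul]
    exact mul_le_mul_of_nonneg_left (hb y) (abs_nonneg _)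
  have e1 : LP ρ l (fun t => LP ρ a f t * LP ρ b g t) x = ∫ w, ∫ z : ℝ × ℝ,
      lpKernel ρ l w * ((lpKernel ρ a (x - w - z.1) * f z.1) * (lpKernel ρ b (x - w - z.2) * g z.2)) := by
    simp only [LP_eq_swap ρ a, LP_eq_swap ρ b]
    unfold LP
    congr 1
    funext w
    rw [integral_const_mul, Measure.volume_eq_prod, integral_prod_mul (fun y => lpKernel ρ a (x - w - y) * f y)
      (fun y => lpKernel ρ b (x - w - y) * g y)]
  rw [e1]
  have hint : Integrable (Function.uncurry fun (w : ℝ) (z : ℝ × ℝ) =>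
      lpKernel ρ l w * ((lpKernel ρ a (x - w - z.1) * f z.1) * (lpKernel ρ b (x - w - z.2) * g z.2)))
      (volume.prod volume) := by
    have hm : Continuous (Function.uncurry fun (w : ℝ) (z : ℝ × ℝ) =>
      lpKernel ρ l w * ((lpKernel ρ a (x - w - z.1) * f z.1) * (lpKernel ρ b (x - w - z.2) * g z.2))) := by
      unfold Function.uncurry
      fun_prop
    rw [integrable_prod_iff hm.aestronglyMeasurable]
    constructor
    · filter_upwards with w
      exact ((i0 a f Bf hfc hbf (x - w)).mul_prod (i0 b g Bg hgc hbg (x - w))).const_mul (lpKernel ρ l w)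
    · refine Integrable.mono' (g := fun w => |lpKernel ρ l w| * (K * Bf * (K * Bg))) (hli.abs.mul_const _)
        hm.norm.aestronglyMeasurable.integral_prod_right' ?_
      filter_upwards with w
      rw [Real.norm_eq_abs, abs_of_nonneg (integral_nonneg fun _ => norm_nonneg _)]
      simp only [Function.uncurry, Real.norm_eq_abs, abs_mul (lpKernel ρ l w)]
      rw [integral_const_mul]
      apply mul_le_mul_of_nonneg_left _ (abs_nonneg _)
      simp only [abs_mul (lpKernel ρ a _ * f _)]
      rw [Measure.volume_eq_prod, integral_prod_mul (fun y => |lpKernel ρ a (x - w - y) * f y|)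
        (fun y => |lpKernel ρ b (x - w - y) * g y|)]
      exact mul_le_mul (ib a f Bf hBf hbf _) (ib b g Bg hBg hbg _) (integral_nonneg fun _ => abs_nonneg _)
        (by positivity)
  rw [integral_integral_swap hint]
  have e2 : ∀ z : ℝ × ℝ, ∫ w,
      lpKernel ρ l w * ((lpKernel ρ a (x - w - z.1) * f z.1) * (lpKernel ρ b (x - w - z.2) * g z.2)) = 0 := by
    intro z
    have h0 := kernel_tri hρ a b l h (x - z.1) (x - z.2)
    have : ∀ w, lpKernel ρ l w * ((lpKernel ρ a (x - w - z.1) * f z.1) * (lpKernel ρ b (x - w - z.2) * g z.2))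
      = lpKernel ρ l w * (lpKernel ρ a (x - z.1 - w) * lpKernel ρ b (x - z.2 - w)) * (f z.1 * g z.2) := by
      intro w
      rw [sub_right_comm x w, sub_right_comm x w]; ring
    simp_rw [this]
    rw [integral_mul_const, h0, zero_mul]
  simp_rw [e2]
  simp

lemma LP_sum_fun {ρ : ℝ → ℝ} (hρ : IsLPCutoff ρ) (k : ℕ) {ι : Type*} (s : Finset ι) (f : ι → ℝ → ℝ)
    (hf : ∀ i ∈ s, BC (f i)) (x : ℝ) :
    LP ρ k (fun t => ∑ i ∈ s, f i t) x = ∑ i ∈ s, LP ρ k (f i) x := by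
  unfold LP
  simp_rw [Finset.mul_sum]
  rw [integral_finsetSum]
  intro i hi
  exact ((hf i hi).comp (g := fun y => x - y) (by fun_prop)).integrable_mul (lpKernel_props hρ k).2.1

lemma LP_abs_le {ρ : ℝ → ℝ} (hρ : IsLPCutoff ρ) {K : ℝ} (hK : ∀ k, ∫ x, |lpKernel ρ k x| ≤ K) (k : ℕ)
    {f : ℝ → ℝ} (B : ℝ) (hB : 0 ≤ B) (hb : ∀ x, |f x| ≤ B) (x : ℝ) : |LP ρ k f x| ≤ K * B :=
  abs_conv_le (lpKernel_props hρ k).2.1 B K hB (hK k) fun _ => hb _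

/-- One-dimensional product estimate in terms of the dyadic pieces. -/
lemma LP_product {ρ : ℝ → ℝ} (hρ : IsLPCutoff ρ) {K : ℝ} (hK : ∀ k, ∫ x, |lpKernel ρ k x| ≤ K)
    (l : ℕ) {f g : ℝ → ℝ} (hf : BC f) (hg : BC g) (p q : ℕ → ℝ) (hp : ∀ a x, |LP ρ a f x| ≤ p a)
    (hq : ∀ a x, |LP ρ a g x| ≤ q a) (D : ℝ)
    (hD : ∀ n : ℕ, ∑ z ∈ (Finset.range (n + 1) ×ˢ Finset.range (n + 1)).filter (fun z => Compat z.1 z.2 l),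
      p z.1 * q z.2 ≤ D) (x : ℝ) :
    |LP ρ l (fun t => f t * g t) x| ≤ K * D := by
  have hK0 : 0 ≤ K := (integral_nonneg fun _ => abs_nonneg _).trans (hK 0)
  have hp0 : ∀ a, 0 ≤ p a := fun a => (abs_nonneg _).trans (hp a 0)
  have hq0 : ∀ a, 0 ≤ q a := fun a => (abs_nonneg _).trans (hq a 0)
  obtain ⟨Bf, hBf, hbf⟩ := LP_sum_bound hρ hf
  obtain ⟨Bg, hBg, hbg⟩ := LP_sum_bound hρ hg
  obtain ⟨hlc, hli, -⟩ := lpKernel_props hρ l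
  have hfin : ∀ n : ℕ, |LP ρ l (fun t => (∑ k ∈ Finset.range (n + 1), LP ρ k f t) *
      (∑ k ∈ Finset.range (n + 1), LP ρ k g t)) x| ≤ K * D := by
    intro n
    have e : (fun t => (∑ k ∈ Finset.range (n + 1), LP ρ k f t) * (∑ k ∈ Finset.range (n + 1), LP ρ k g t)) =
        fun t => ∑ z ∈ Finset.range (n + 1) ×ˢ Finset.range (n + 1), LP ρ z.1 f t * LP ρ z.2 g t := by
      funext t
      rw [Finset.sum_mul_sum, Finset.sum_product]
    rw [e, LP_sum_fun hρ l _ (fun (z : ℕ × ℕ) t => LP ρ z.1 f t * LP ρ z.2 g t)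
      (fun z _ => (LP_BC hρ _ hf).mul (LP_BC hρ _ hg))]
    rw [← Finset.sum_filter_add_sum_filter_not _ (fun z : ℕ × ℕ => Compat z.1 z.2 l)]
    rw [Finset.sum_eq_zero (s := Finset.filter (fun z : ℕ × ℕ => ¬ Compat z.1 z.2 l) _), add_zero]
    · refine (Finset.abs_sum_le_sum_abs _ _).trans ?_
      refine le_trans (Finset.sum_le_sum (g := fun z : ℕ × ℕ => K * (p z.1 * q z.2)) fun z _ => ?_) ?_
      · apply LP_abs_le hρ hK l _ (mul_nonneg (hp0 _) (hq0 _))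
        intro t
        rw [abs_mul]
        exact mul_le_mul (hp _ _) (hq _ _) (abs_nonneg _) (hp0 _)
      · rw [← Finset.mul_sum]
        exact mul_le_mul_of_nonneg_left (hD n) hK0
    · intro z hz
      exact LP_tri_zero hρ _ _ _ (Finset.mem_filter.mp hz).2 hf hg x
  have hlim : Filter.Tendsto (fun n : ℕ => LP ρ l (fun t => (∑ k ∈ Finset.range (n + 1), LP ρ k f t) *
      (∑ k ∈ Finset.range (n + 1), LP ρ k g t)) x) Filter.atTop
      (nhds (LP ρ l (fun t => (Real.sqrt (2 * π) * f t) * (Real.sqrt (2 * π) * g t)) x)) := by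
    unfold LP
    refine tendsto_integral_of_dominated_convergence (fun y => |lpKernel ρ l y| * (Bf * Bg)) ?_
      (hli.abs.mul_const _) ?_ ?_
    · intro n
      have h1 := (BC.sum (Finset.range (n + 1)) (fun k _ => LP_BC hρ k hf)).1
      have h2 := (BC.sum (Finset.range (n + 1)) (fun k _ => LP_BC hρ k hg)).1
      exact (hlc.mul ((h1.mul h2).comp (continuous_const.sub continuous_id))).aestronglyMeasurable
    · intro n
      filter_upwards with y
      rw [Real.norm_eq_abs, abs_mul, abs_mul]
      exact mul_le_mul_of_nonneg_left (mul_le_mul (hbf n _) (hbg n _) (abs_nonneg _) hBf) (abs_nonneg _)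
    · filter_upwards with y
      exact ((LP_sum_tendsto hρ hf _).mul (LP_sum_tendsto hρ hg _)).const_mul _
  have h3 := le_of_tendsto hlim.abs (Filter.Eventually.of_forall hfin)
  have h4 : LP ρ l (fun t => (Real.sqrt (2 * π) * f t) * (Real.sqrt (2 * π) * g t)) x =
      (2 * π) * LP ρ l (fun t => f t * g t) x := by
    unfold LP
    rw [← integral_const_mul]
    congr 1
    funext y
    have := Real.mul_self_sqrt (show 0 ≤ 2 * π by positivity)
    linear_combination (lpKernel ρ l y * f (x - y) * g (x - y)) * this
  rw [h4, abs_mul, abs_of_pos (by positivity)] at h3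
  refine le_trans ?_ h3
  have := Real.pi_gt_three
  nlinarith [abs_nonneg (LP ρ l (fun t => f t * g t) x)]

lemma pow_near (s : ℝ) (hs : 0 < s) (c b l : ℕ) (h1 : b ≤ l + c) (h2 : l ≤ b + c) :
    s ^ b ≤ (max s s⁻¹) ^ c * s ^ l := by
  have hm : 1 ≤ max s s⁻¹ := by
    rcases le_total 1 s with h | h
    · exact le_max_of_le_left h
    · exact le_max_of_le_right ((one_le_inv₀ hs).mpr h)
  rcases le_total l b with h | h
  · obtain ⟨j, rfl⟩ := Nat.exists_eq_add_of_le h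
    rw [pow_add, mul_comm]
    apply mul_le_mul_of_nonneg_right _ (by positivity)
    exact (pow_le_pow_left₀ hs.le (le_max_left _ _) j).trans (pow_le_pow_right₀ hm (by omega))
  · obtain ⟨j, rfl⟩ := Nat.exists_eq_add_of_le h
    have : s ^ b = (s⁻¹) ^ j * s ^ (b + j) := by
      rw [pow_add, inv_pow]; field_simp
    rw [this]
    apply mul_le_mul_of_nonneg_right _ (by positivity)
    exact (pow_le_pow_left₀ (by positivity) (le_max_right _ _) j).trans (pow_le_pow_right₀ hm (by omega))

lemma geom_any (r : ℝ) (hr : 0 < r) (hr1 : r ≠ 1) :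
    ∃ C : ℝ, 0 ≤ C ∧ ∀ l : ℕ, ∑ a ∈ Finset.range (l + 1), r ^ a ≤ C * max 1 (r ^ l) := by
  rcases lt_or_gt_of_ne hr1 with h | h
  · refine ⟨1 / (1 - r), by have : 0 < 1 - r := by linarith
                            positivity, fun l => ?_⟩
    have hp : 0 < 1 - r := by linarith
    have h1 := geom_sum_Ico_le_of_lt_one (m := 0) (n := l + 1) hr.le h
    rw [← Finset.range_eq_Ico, pow_zero] at h1
    refine h1.trans ?_
    exact le_mul_of_one_le_right (by positivity) (le_max_left _ _)
  · have hp : 0 < r - 1 := by linarith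
    refine ⟨r / (r - 1), by positivity, fun l => ?_⟩
    rw [geom_sum_eq hr1]
    calc (r ^ (l + 1) - 1) / (r - 1) ≤ r ^ (l + 1) / (r - 1) := by
          apply div_le_div_of_nonneg_right _ hp.le; linarith
      _ = r / (r - 1) * r ^ l := by rw [pow_succ]; ring
      _ ≤ _ := mul_le_mul_of_nonneg_left (le_max_right _ _) (by positivity)

lemma sum_type1 (r s t : ℝ) (hr : 0 < r) (hs : 0 < s) (hr1 : r ≠ 1) (h1 : s ≤ t) (h2 : r * s ≤ t) :
    ∃ C : ℝ, 0 ≤ C ∧ ∀ (l : ℕ) (S : Finset (ℕ × ℕ)),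
      (∀ z ∈ S, z.1 ≤ l ∧ z.2 ≤ l + 2 ∧ l ≤ z.2 + 2) → ∑ z ∈ S, r ^ z.1 * s ^ z.2 ≤ C * t ^ l := by
  obtain ⟨C, hC, hCb⟩ := geom_any r hr hr1
  have hm : 0 < max s s⁻¹ := lt_max_of_lt_left hs
  refine ⟨C * (5 * (max s s⁻¹) ^ 2), by positivity, fun l S hS => ?_⟩
  have hsub : S ⊆ Finset.range (l + 1) ×ˢ Finset.Icc (l - 2) (l + 2) := by
    intro z hz
    have := hS z hz
    simp only [Finset.mem_product, Finset.mem_range, Finset.mem_Icc]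
    omega
  refine (Finset.sum_le_sum_of_subset_of_nonneg hsub fun z _ _ => by positivity).trans ?_
  rw [Finset.sum_product]
  simp only
  rw [← Finset.sum_mul_sum]
  have hb : ∑ b ∈ Finset.Icc (l - 2) (l + 2), s ^ b ≤ 5 * (max s s⁻¹) ^ 2 * s ^ l := by
    have := Finset.sum_le_card_nsmul (Finset.Icc (l - 2) (l + 2)) (fun b => s ^ b)
      ((max s s⁻¹) ^ 2 * s ^ l) (fun b hb => by
        rw [Finset.mem_Icc] at hb
        exact pow_near s hs 2 b l (by omega) (by omega))
    refine this.trans ?_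
    rw [nsmul_eq_mul, mul_assoc]
    apply mul_le_mul_of_nonneg_right _ (by positivity)
    have : (Finset.Icc (l - 2) (l + 2)).card ≤ 5 := by rw [Nat.card_Icc]; omega
    exact_mod_cast this
  have hmax : max 1 (r ^ l) * s ^ l ≤ t ^ l := by
    rw [max_mul_of_nonneg _ _ (by positivity), one_mul, ← mul_pow]
    exact max_le (pow_le_pow_left₀ hs.le h1 l) (pow_le_pow_left₀ (by positivity) h2 l)
  calc _ ≤ (C * max 1 (r ^ l)) * (5 * (max s s⁻¹) ^ 2 * s ^ l) :=
        mul_le_mul (hCb l) hb (Finset.sum_nonneg fun _ _ => by positivity) (by positivity)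
    _ = C * (5 * (max s s⁻¹) ^ 2) * (max 1 (r ^ l) * s ^ l) := by ring
    _ ≤ _ := mul_le_mul_of_nonneg_left hmax (by positivity)

lemma sum_type2 (r s t : ℝ) (hr : 0 < r) (hs : 0 < s) (hs1 : s ≠ 1) (h1 : r ≤ t) (h2 : r * s ≤ t) :
    ∃ C : ℝ, 0 ≤ C ∧ ∀ (l : ℕ) (S : Finset (ℕ × ℕ)),
      (∀ z ∈ S, z.2 ≤ l ∧ z.1 ≤ l + 2 ∧ l ≤ z.1 + 2) → ∑ z ∈ S, r ^ z.1 * s ^ z.2 ≤ C * t ^ l := by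
  obtain ⟨C, hC, hCb⟩ := sum_type1 s r t hs hr hs1 h1 (by rwa [mul_comm])
  refine ⟨C, hC, fun l S hS => ?_⟩
  have := hCb l (S.map (Equiv.prodComm ℕ ℕ).toEmbedding) (by
    intro z hz
    rw [Finset.mem_map] at hz
    obtain ⟨w, hw, rfl⟩ := hz
    exact hS w hw)
  rw [Finset.sum_map] at this
  refine le_trans (le_of_eq (Finset.sum_congr rfl fun z _ => ?_)) this
  simp [mul_comm]

lemma sum_type3 (r s t : ℝ) (hr : 0 < r) (hs : 0 < s) (h1 : r * s < 1) (h2 : r * s ≤ t) :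
    ∃ C : ℝ, 0 ≤ C ∧ ∀ (l : ℕ) (S : Finset (ℕ × ℕ)),
      (∀ z ∈ S, l ≤ z.1 + 2 ∧ z.1 ≤ z.2 + 4 ∧ z.2 ≤ z.1 + 4) →
        ∑ z ∈ S, r ^ z.1 * s ^ z.2 ≤ C * t ^ l := by
  set x := r * s with hx
  have hx0 : 0 < x := by positivity
  have hp : 0 < 1 - x := by linarith
  have hm : 0 < max s s⁻¹ := lt_max_of_lt_left hs
  have hmx : 0 < max x x⁻¹ := lt_max_of_lt_left hx0
  refine ⟨(max s s⁻¹) ^ 4 * (9 * ((max x x⁻¹) ^ 2 / (1 - x))), by positivity, fun l S hS => ?_⟩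
  have step1 : ∑ z ∈ S, r ^ z.1 * s ^ z.2 ≤ (max s s⁻¹) ^ 4 * ∑ z ∈ S, x ^ z.1 := by
    rw [Finset.mul_sum]
    refine Finset.sum_le_sum fun z hz => ?_
    have h := hS z hz
    have := pow_near s hs 4 z.2 z.1 (by omega) (by omega)
    calc r ^ z.1 * s ^ z.2 ≤ r ^ z.1 * ((max s s⁻¹) ^ 4 * s ^ z.1) :=
          mul_le_mul_of_nonneg_left this (by positivity)
      _ = _ := by rw [hx, mul_pow]; ring
  obtain ⟨N, hN⟩ : ∃ N, ∀ z ∈ S, z.1 < N := by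
    refine ⟨S.sup (fun z => z.1) + 1, fun z hz => ?_⟩
    have := Finset.le_sup (f := fun z : ℕ × ℕ => z.1) hz
    exact Nat.lt_succ_of_le this
  have step2 : ∑ z ∈ S, x ^ z.1 ≤ 9 * ∑ a ∈ Finset.Ico (l - 2) N, x ^ a := by
    have hinj : Set.InjOn (fun z : ℕ × ℕ => (z.1, z.2 + 4 - z.1)) S := by
      rintro ⟨a, b⟩ hz ⟨a', b'⟩ hz' h
      have h3 := hS _ hz
      have h4 := hS _ hz'
      simp only [Prod.mk.injEq] at h h3 h4 ⊢
      omega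
    have := Finset.sum_image (f := fun z : ℕ × ℕ => x ^ z.1) hinj
    simp only at this
    rw [← this]
    refine (Finset.sum_le_sum_of_subset_of_nonneg
      (t := Finset.Ico (l - 2) N ×ˢ Finset.range 9) ?_ fun z _ _ => by positivity).trans ?_
    · intro w hw
      rw [Finset.mem_image] at hw
      obtain ⟨z, hz, rfl⟩ := hw
      have h3 := hS _ hz
      have h4 := hN _ hz
      simp only [Finset.mem_product, Finset.mem_range, Finset.mem_Ico]
      omega
    · rw [Finset.sum_product_right]
      simp
  have step3 : ∑ a ∈ Finset.Ico (l - 2) N, x ^ a ≤ (max x x⁻¹) ^ 2 / (1 - x) * t ^ l := by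
    refine (geom_sum_Ico_le_of_lt_one hx0.le h1).trans ?_
    rw [div_mul_eq_mul_div]
    apply div_le_div_of_nonneg_right _ hp.le
    refine (pow_near x hx0 2 (l - 2) l (by omega) (by omega)).trans ?_
    exact mul_le_mul_of_nonneg_left (pow_le_pow_left₀ hx0.le h2 l) (by positivity)
  calc _ ≤ _ := step1
    _ ≤ (max s s⁻¹) ^ 4 * (9 * ((max x x⁻¹) ^ 2 / (1 - x) * t ^ l)) := by
        apply mul_le_mul_of_nonneg_left _ (by positivity)
        exact step2.trans (mul_le_mul_of_nonneg_left step3 (by norm_num))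
    _ = _ := by ring

lemma sum_compat (r s t : ℝ) (hr : 0 < r) (hs : 0 < s) (hr1 : r ≠ 1) (hs1 : s ≠ 1)
    (h1 : s ≤ t) (h2 : r ≤ t) (h3 : r * s ≤ t) (h4 : r * s < 1) :
    ∃ C : ℝ, 0 ≤ C ∧ ∀ (l : ℕ) (S : Finset (ℕ × ℕ)), (∀ z ∈ S, Compat z.1 z.2 l) →
        ∑ z ∈ S, r ^ z.1 * s ^ z.2 ≤ C * t ^ l := by
  obtain ⟨C1, hC1, hb1⟩ := sum_type1 r s t hr hs hr1 h1 h3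
  obtain ⟨C2, hC2, hb2⟩ := sum_type2 r s t hr hs hs1 h2 h3
  obtain ⟨C3, hC3, hb3⟩ := sum_type3 r s t hr hs h4 h3
  refine ⟨C1 + (C2 + C3), by positivity, fun l S hS => ?_⟩
  rw [← Finset.sum_filter_add_sum_filter_not S (fun z => z.1 + 2 < l),
    ← Finset.sum_filter_add_sum_filter_not (S.filter fun z => ¬ z.1 + 2 < l) (fun z => z.2 + 2 < l), add_mul, add_mul]
  refine add_le_add (hb1 l _ ?_) (add_le_add (hb2 l _ ?_) (hb3 l _ ?_))
  · intro z hz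
    simp only [Finset.mem_filter] at hz
    have := hS z (by tauto)
    unfold Compat at this
    omega
  · intro z hz
    simp only [Finset.mem_filter] at hz
    have := hS z (by tauto)
    unfold Compat at this
    omega
  · intro z hz
    simp only [Finset.mem_filter] at hz
    have := hS z (by tauto)
    unfold Compat at this
    omega

lemma DLow_iff (a b : ℕ) : DLow a b ↔ a + 10 ≤ b := by
  unfold DLow
  rw [le_div_iff₀ (by positivity), ← pow_add]
  exact pow_le_pow_iff_right₀ (by norm_num)

lemma sum_nonres (r s t : ℝ) (hr : 0 < r) (hs : 0 < s) (hr1 : r ≠ 1) (hs1 : s ≠ 1)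
    (h1 : s ≤ t) (h2 : r ≤ t) (h3 : r * s ≤ t) :
    ∃ C : ℝ, 0 ≤ C ∧ ∀ (l : ℕ) (S : Finset (ℕ × ℕ)),
      (∀ z ∈ S, Compat z.1 z.2 l ∧ (DLow z.1 z.2 ∨ DLow z.2 z.1)) →
        ∑ z ∈ S, r ^ z.1 * s ^ z.2 ≤ C * t ^ l := by
  obtain ⟨C1, hC1, hb1⟩ := sum_type1 r s t hr hs hr1 h1 h3
  obtain ⟨C2, hC2, hb2⟩ := sum_type2 r s t hr hs hs1 h2 h3
  refine ⟨C1 + C2, by positivity, fun l S hS => ?_⟩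
  rw [← Finset.sum_filter_add_sum_filter_not S (fun z => z.1 < z.2), add_mul]
  refine add_le_add (hb1 l _ ?_) (hb2 l _ ?_)
  · intro z hz
    simp only [Finset.mem_filter] at hz
    have := hS z (by tauto)
    simp only [DLow_iff, Compat] at this
    omega
  · intro z hz
    simp only [Finset.mem_filter] at hz
    have := hS z (by tauto)
    simp only [DLow_iff, Compat] at this
    omega

lemma LPu_eq (ρ : ℝ → ℝ) (k : ℕ) (F : ℝ × ℝ → ℝ) (p : ℝ × ℝ) :
    LPu ρ k F p = LP ρ k (fun t => F (t, p.2)) p.1 := rfl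

lemma LPv_eq (ρ : ℝ → ℝ) (k : ℕ) (F : ℝ × ℝ → ℝ) (p : ℝ × ℝ) :
    LPv ρ k F p = LP ρ k (fun t => F (p.1, t)) p.2 := rfl

lemma LPu_BC {ρ : ℝ → ℝ} (hρ : IsLPCutoff ρ) (k : ℕ) {F : ℝ × ℝ → ℝ} (hF : BC F) : BC (LPu ρ k F) := by
  obtain ⟨h1, h2, -⟩ := lpKernel_props hρ k
  exact BC.conv h1 h2 (H := fun (p : ℝ × ℝ) y => F (p.1 - y, p.2))
    (hF.comp (g := fun q : (ℝ × ℝ) × ℝ => (q.1.1 - q.2, q.1.2)) (by fun_prop))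

lemma LPv_BC {ρ : ℝ → ℝ} (hρ : IsLPCutoff ρ) (k : ℕ) {F : ℝ × ℝ → ℝ} (hF : BC F) : BC (LPv ρ k F) := by
  obtain ⟨h1, h2, -⟩ := lpKernel_props hρ k
  exact BC.conv h1 h2 (H := fun (p : ℝ × ℝ) y => F (p.1, p.2 - y))
    (hF.comp (g := fun q : (ℝ × ℝ) × ℝ => (q.1.1, q.1.2 - q.2)) (by fun_prop))

lemma LP_comm {ρ : ℝ → ℝ} (hρ : IsLPCutoff ρ) (k l : ℕ) {F : ℝ × ℝ → ℝ} (hF : BC F) (p : ℝ × ℝ) :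
    LPu ρ k (LPv ρ l F) p = LPv ρ l (LPu ρ k F) p := by
  obtain ⟨hkc, hki, -⟩ := lpKernel_props hρ k
  obtain ⟨hlc, hli, -⟩ := lpKernel_props hρ l
  obtain ⟨hc, B, hB, hb⟩ := hF
  unfold LPu LPv
  simp only
  simp_rw [← integral_const_mul]
  have hint : Integrable (Function.uncurry fun y z : ℝ =>
      lpKernel ρ k y * (lpKernel ρ l z * F (p.1 - y, p.2 - z))) (volume.prod volume) := by
    have i1 : Integrable (fun q : ℝ × ℝ => lpKernel ρ k q.1 * lpKernel ρ l q.2) (volume.prod volume) :=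
      hki.mul_prod hli
    have i2 := i1.mul_bdd (c := B) (g := fun q : ℝ × ℝ => F (p.1 - q.1, p.2 - q.2))
      (Continuous.aestronglyMeasurable (by fun_prop))
      (by filter_upwards with q using by simpa using hb _)
    refine i2.congr (Filter.Eventually.of_forall fun q => ?_)
    simp only [Function.uncurry]
    ring
  rw [integral_integral_swap hint]
  congr 1
  funext z
  congr 1
  funext y
  ring

lemma BC_of_CbSmooth {F : ℝ × ℝ → ℝ} (hF : CbSmooth F) : BC F := by
  refine ⟨hF.1.continuous, ?_⟩
  obtain ⟨C, hC⟩ := hF.2 0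
  have : ∀ x, |F x| ≤ C := fun x => by simpa using hC x
  exact ⟨C, (abs_nonneg _).trans (this 0), this⟩

/-- The main estimate, in terms of real numbers. -/
lemma main_real {ρ : ℝ → ℝ} (hρ : IsLPCutoff ρ) (r₁ r₂ s₁ s₂ t₁ t₂ : ℝ)
    (hr₁ : 0 < r₁) (hr₂ : 0 < r₂) (hs₁ : 0 < s₁) (hs₂ : 0 < s₂)
    (hr₁' : r₁ ≠ 1) (hr₂' : r₂ ≠ 1) (hs₁' : s₁ ≠ 1) (hs₂' : s₂ ≠ 1)
    (h1 : s₁ ≤ t₁) (h2 : r₁ ≤ t₁) (h3 : r₁ * s₁ ≤ t₁)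
    (k1 : s₂ ≤ t₂) (k2 : r₂ ≤ t₂) (k3 : r₂ * s₂ ≤ t₂) (k4 : r₂ * s₂ < 1) :
    ∃ C : ℝ, 0 ≤ C ∧ ∀ (F G : ℝ × ℝ → ℝ) (X Y : ℝ), BC F → BC G → 0 ≤ X → 0 ≤ Y →
      (∀ k l p, |LPu ρ k (LPv ρ l F) p| ≤ X * (r₁ ^ k * r₂ ^ l)) →
      (∀ k l p, |LPu ρ k (LPv ρ l G) p| ≤ Y * (s₁ ^ k * s₂ ^ l)) →
      ∀ S : Finset (ℕ × ℕ), (∀ q ∈ S, DLow q.1 q.2 ∨ DLow q.2 q.1) → ∀ k l p,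
        |LPu ρ k (LPv ρ l (fun p => ∑ q ∈ S, LPu ρ q.1 F p * LPu ρ q.2 G p)) p| ≤
          C * X * Y * (t₁ ^ k * t₂ ^ l) := by
  obtain ⟨K, hK0, hK⟩ := lpKernel_L1 ρ
  obtain ⟨C1, hC1, hb1⟩ := sum_nonres r₁ s₁ t₁ hr₁ hs₁ hr₁' hs₁' h1 h2 h3
  obtain ⟨C2, hC2, hb2⟩ := sum_compat r₂ s₂ t₂ hr₂ hs₂ hr₂' hs₂' k1 k2 k3 k4
  have ht₂ : 0 < t₂ := hs₂.trans_le k1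
  refine ⟨K * K * C2 * C1, by positivity, fun F G X Y hF hG hX hY hFb hGb S hS k l p => ?_⟩
  have hBC : ∀ q : ℕ × ℕ, BC (fun p => LPu ρ q.1 F p * LPu ρ q.2 G p) := fun q =>
    (LPu_BC hρ _ hF).mul (LPu_BC hρ _ hG)
  have e1 : LPv ρ l (fun p => ∑ q ∈ S, LPu ρ q.1 F p * LPu ρ q.2 G p) =
      fun p => ∑ q ∈ S, LPv ρ l (fun p => LPu ρ q.1 F p * LPu ρ q.2 G p) p := by
    funext p
    simp only [LPv_eq]
    exact LP_sum_fun hρ l S (fun (q : ℕ × ℕ) t => LPu ρ q.1 F (p.1, t) * LPu ρ q.2 G (p.1, t))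
      (fun q _ => (hBC q).comp (g := fun t => (p.1, t)) (by fun_prop)) p.2
  have e2 : LPu ρ k (fun p => ∑ q ∈ S, LPv ρ l (fun p => LPu ρ q.1 F p * LPu ρ q.2 G p) p) p =
      ∑ q ∈ S, LPu ρ k (LPv ρ l (fun p => LPu ρ q.1 F p * LPu ρ q.2 G p)) p := by
    exact LP_sum_fun hρ k S (fun (q : ℕ × ℕ) t => LPv ρ l (fun p => LPu ρ q.1 F p * LPu ρ q.2 G p) (t, p.2))
      (fun q _ => (LPv_BC hρ l (hBC q)).comp (g := fun t => (t, p.2)) (by fun_prop)) p.1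
  rw [e1, e2, ← Finset.sum_filter_add_sum_filter_not S (fun q => Compat q.1 q.2 k)]
  rw [Finset.sum_eq_zero (s := S.filter fun q => ¬ Compat q.1 q.2 k), add_zero]
  · refine (Finset.abs_sum_le_sum_abs _ _).trans ?_
    refine (Finset.sum_le_sum (g := fun q : ℕ × ℕ => K * K * C2 * X * Y * t₂ ^ l * (r₁ ^ q.1 * s₁ ^ q.2))
      fun q _ => ?_).trans ?_
    · have hv : ∀ p', |LPv ρ l (fun p => LPu ρ q.1 F p * LPu ρ q.2 G p) p'| ≤
          K * (X * Y * (r₁ ^ q.1 * s₁ ^ q.2) * (C2 * t₂ ^ l)) := by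
        intro p'
        refine LP_product hρ hK l (f := fun t => LPu ρ q.1 F (p'.1, t)) (g := fun t => LPu ρ q.2 G (p'.1, t))
          ((LPu_BC hρ _ hF).comp (by fun_prop)) ((LPu_BC hρ _ hG).comp (by fun_prop))
          (fun a => X * (r₁ ^ q.1 * r₂ ^ a)) (fun a => Y * (s₁ ^ q.2 * s₂ ^ a)) ?_ ?_ _ ?_ p'.2
        · intro a x
          have := hFb q.1 a (p'.1, x)
          rw [LP_comm hρ _ _ hF] at this
          exact this
        · intro a x
          have := hGb q.2 a (p'.1, x)
          rw [LP_comm hρ _ _ hG] at this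
          exact this
        · intro n
          have := hb2 l ((Finset.range (n + 1) ×ˢ Finset.range (n + 1)).filter (fun z => Compat z.1 z.2 l))
            (fun z hz => (Finset.mem_filter.mp hz).2)
          refine le_trans (le_of_eq ?_) (mul_le_mul_of_nonneg_left this
            (show 0 ≤ X * Y * (r₁ ^ q.1 * s₁ ^ q.2) by positivity))
          rw [Finset.mul_sum]
          exact Finset.sum_congr rfl fun z _ => by ring
      have := LP_abs_le hρ hK k (f := fun t => LPv ρ l (fun p => LPu ρ q.1 F p * LPu ρ q.2 G p) (t, p.2))
        _ (by positivity) (fun x => hv (x, p.2)) p.1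
      refine le_trans this (le_of_eq ?_)
      ring
    · rw [← Finset.mul_sum]
      have := hb1 k (S.filter fun q => Compat q.1 q.2 k) (fun z hz => by
        rw [Finset.mem_filter] at hz
        exact ⟨hz.2, hS z hz.1⟩)
      refine (mul_le_mul_of_nonneg_left this (by positivity)).trans (le_of_eq ?_)
      ring
  · intro q hq
    have hq' := (Finset.mem_filter.mp hq).2
    rw [LP_comm hρ _ _ (hBC q)]
    have hz : ∀ p', LPu ρ k (fun p => LPu ρ q.1 F p * LPu ρ q.2 G p) p' = 0 := fun p' =>
      LP_tri_zero hρ q.1 q.2 k hq' (f := fun t => F (t, p'.2)) (g := fun t => G (t, p'.2))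
        (hF.comp (by fun_prop)) (hG.comp (by fun_prop)) p'.1
    unfold LPv
    simp [hz]

lemma hNorm2_bound (ρ : ℝ → ℝ) (a b : ℝ) (F : ℝ × ℝ → ℝ) (h : hNorm2 ρ a b F ≠ ∞) (k l : ℕ) (p : ℝ × ℝ) :
    |LPu ρ k (LPv ρ l F) p| ≤ (hNorm2 ρ a b F).toReal * (((2:ℝ) ^ (-a)) ^ k * ((2:ℝ) ^ (-b)) ^ l) := by
  have h1 : ENNReal.ofReal (((2 : ℝ) ^ k) ^ a * ((2 : ℝ) ^ l) ^ b) *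
      ENNReal.ofReal |LPu ρ k (LPv ρ l F) p| ≤ hNorm2 ρ a b F := by
    unfold hNorm2
    refine le_trans ?_ (le_iSup₂ k l)
    gcongr
    exact le_iSup (fun p => ENNReal.ofReal |LPu ρ k (LPv ρ l F) p|) p
  rw [← ENNReal.ofReal_mul (by positivity)] at h1
  have h2 := (ENNReal.ofReal_le_iff_le_toReal h).mp h1
  have e : ∀ (c : ℝ) (m : ℕ), ((2:ℝ) ^ m) ^ c * ((2:ℝ) ^ (-c)) ^ m = 1 := by
    intro c m
    rw [← Real.rpow_natCast, ← Real.rpow_natCast, ← Real.rpow_mul (by norm_num), ← Real.rpow_mul (by norm_num),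
      ← Real.rpow_add (by norm_num)]
    ring_nf
    simp
  have h3 := mul_le_mul_of_nonneg_right h2
    (show 0 ≤ ((2:ℝ) ^ (-a)) ^ k * ((2:ℝ) ^ (-b)) ^ l by positivity)
  refine le_trans (le_of_eq ?_) h3
  linear_combination (-|LPu ρ k (LPv ρ l F) p|) * (((2:ℝ) ^ l) ^ b * ((2:ℝ) ^ (-b)) ^ l * e a k + e b l)

lemma hNorm2_le (ρ : ℝ → ℝ) (a b : ℝ) (F : ℝ × ℝ → ℝ) (M : ℝ)
    (h : ∀ k l p, |LPu ρ k (LPv ρ l F) p| ≤ M * (((2:ℝ) ^ (-a)) ^ k * ((2:ℝ) ^ (-b)) ^ l)) :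
    hNorm2 ρ a b F ≤ ENNReal.ofReal M := by
  unfold hNorm2
  refine iSup₂_le fun k l => ?_
  rw [ENNReal.mul_iSup]
  refine iSup_le fun p => ?_
  rw [← ENNReal.ofReal_mul (by positivity)]
  apply ENNReal.ofReal_le_ofReal
  have e : ∀ (c : ℝ) (m : ℕ), ((2:ℝ) ^ m) ^ c * ((2:ℝ) ^ (-c)) ^ m = 1 := by
    intro c m
    rw [← Real.rpow_natCast, ← Real.rpow_natCast, ← Real.rpow_mul (by norm_num), ← Real.rpow_mul (by norm_num),
      ← Real.rpow_add (by norm_num)]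
    ring_nf
    simp
  refine (mul_le_mul_of_nonneg_left (h k l p) (by positivity)).trans (le_of_eq ?_)
  linear_combination M * (((2:ℝ) ^ l) ^ b * ((2:ℝ) ^ (-b)) ^ l * e a k + e b l)

lemma LPu_zero_of_hNorm2 {ρ : ℝ → ℝ} (hρ : IsLPCutoff ρ) (a b : ℝ) {F : ℝ × ℝ → ℝ} (hF : BC F)
    (h : hNorm2 ρ a b F = 0) (k : ℕ) (p : ℝ × ℝ) : LPu ρ k F p = 0 := by
  have h0 : ∀ l x, LP ρ l (fun t => LPu ρ k F (p.1, t)) x = 0 := by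
    intro l x
    have := hNorm2_bound ρ a b F (by rw [h]; simp) k l (p.1, x)
    rw [h, LP_comm hρ _ _ hF, ENNReal.toReal_zero, zero_mul] at this
    exact abs_nonpos_iff.mp this
  have ht := LP_sum_tendsto hρ (f := fun t => LPu ρ k F (p.1, t))
    ((LPu_BC hρ k hF).comp (by fun_prop)) p.2
  simp only [h0, Finset.sum_const_zero] at ht
  have := tendsto_nhds_unique ht tendsto_const_nhds
  have hs : Real.sqrt (2 * π) ≠ 0 := by positivity
  exact (mul_eq_zero.mp this).resolve_left hs

lemma hNorm2_zero (ρ : ℝ → ℝ) (a b : ℝ) : hNorm2 ρ a b (fun _ => 0) = 0 := by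
  have := hNorm2_le ρ a b (fun _ => 0) 0 (by intro k l p; simp [LPu, LPv])
  simpa using this

lemma rpow_ne_one {a : ℝ} (ha : a ≠ 0) : (2:ℝ) ^ (-a) ≠ 1 := by
  intro h
  have h2 := congrArg Real.log h
  rw [Real.log_rpow (by norm_num), Real.log_one] at h2
  rcases mul_eq_zero.mp h2 with h3 | h3
  · exact ha (by linarith)
  · exact absurd h3 (Real.log_pos (by norm_num)).ne'

/-- **Proposition 2.6(iii): non-resonant improvement of the bilinear paraproduct estimate.**
For `γ₁ ≤ min (α₁, β₁, α₁+β₁)`, `γ₂ ≤ min (α₂, β₂)` and `α₂ + β₂ > 0`, the non-resonant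
paraproduct `Σ_{(M,N)∈S, M ≁ N} P_M^u F · P_N^u G` obeys the bilinear estimate. -/
theorem bilinear_paraproduct_nonresonant
    (ρ : ℝ → ℝ) (hρ : IsLPCutoff ρ)
    (α₁ α₂ β₁ β₂ γ₁ γ₂ : ℝ)
    (hα₁ : α₁ ≠ 0) (hα₂ : α₂ ≠ 0) (hβ₁ : β₁ ≠ 0) (hβ₂ : β₂ ≠ 0)
    (hγ₁ : γ₁ ≤ min α₁ (min β₁ (α₁ + β₁))) (hγ₂ : γ₂ ≤ min α₂ β₂)
    (hab₂ : 0 < α₂ + β₂) :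
    ∃ C : ℝ≥0∞, C ≠ ∞ ∧ ∀ F G : ℝ × ℝ → ℝ, CbSmooth F → CbSmooth G →
      ∀ S : Finset (ℕ × ℕ),
        (∀ q ∈ S, DLow q.1 q.2 ∨ DLow q.2 q.1) →
        hNorm2 ρ γ₁ γ₂ (fun p => ∑ q ∈ S, LPu ρ q.1 F p * LPu ρ q.2 G p) ≤
          C * hNorm2 ρ α₁ α₂ F * hNorm2 ρ β₁ β₂ G := by
  have hpos : ∀ a : ℝ, (0:ℝ) < (2:ℝ) ^ (-a) := fun a => by positivity
  have hmono : ∀ a b : ℝ, b ≤ a → (2:ℝ) ^ (-a) ≤ (2:ℝ) ^ (-b) := fun a b h =>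
    Real.rpow_le_rpow_of_exponent_le (by norm_num) (by linarith)
  have hmul : ∀ a b : ℝ, (2:ℝ) ^ (-a) * (2:ℝ) ^ (-b) = (2:ℝ) ^ (-(a + b)) := fun a b => by
    rw [← Real.rpow_add (by norm_num)]; congr 1; ring
  rw [le_min_iff, le_min_iff] at hγ₁
  rw [le_min_iff] at hγ₂
  have hγ₂' : γ₂ ≤ α₂ + β₂ := by
    rcases lt_or_ge α₂ 0 with h | h
    · linarith
    · linarith
  obtain ⟨C, hC, hb⟩ := main_real hρ ((2:ℝ) ^ (-α₁)) ((2:ℝ) ^ (-α₂)) ((2:ℝ) ^ (-β₁)) ((2:ℝ) ^ (-β₂))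
    ((2:ℝ) ^ (-γ₁)) ((2:ℝ) ^ (-γ₂)) (hpos _) (hpos _) (hpos _) (hpos _)
    (rpow_ne_one hα₁) (rpow_ne_one hα₂) (rpow_ne_one hβ₁) (rpow_ne_one hβ₂)
    (hmono _ _ hγ₁.2.1) (hmono _ _ hγ₁.1) (by rw [hmul]; exact hmono _ _ hγ₁.2.2)
    (hmono _ _ hγ₂.2) (hmono _ _ hγ₂.1) (by rw [hmul]; exact hmono _ _ hγ₂')
    (by rw [hmul]; exact Real.rpow_lt_one_of_one_lt_of_neg (by norm_num) (by linarith))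
  refine ⟨ENNReal.ofReal (C + 1), ENNReal.ofReal_ne_top, fun F G hF hG S hS => ?_⟩
  have hF' := BC_of_CbSmooth hF
  have hG' := BC_of_CbSmooth hG
  have hC1 : ENNReal.ofReal (C + 1) ≠ 0 := by
    rw [Ne, ENNReal.ofReal_eq_zero, not_le]; linarith
  by_cases hF0 : hNorm2 ρ α₁ α₂ F = 0
  · have e : (fun p => ∑ q ∈ S, LPu ρ q.1 F p * LPu ρ q.2 G p) = fun _ => 0 := by
      funext p
      exact Finset.sum_eq_zero fun q _ => by rw [LPu_zero_of_hNorm2 hρ _ _ hF' hF0, zero_mul]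
    rw [e, hNorm2_zero]
    exact zero_le
  by_cases hG0 : hNorm2 ρ β₁ β₂ G = 0
  · have e : (fun p => ∑ q ∈ S, LPu ρ q.1 F p * LPu ρ q.2 G p) = fun _ => 0 := by
      funext p
      exact Finset.sum_eq_zero fun q _ => by rw [LPu_zero_of_hNorm2 hρ _ _ hG' hG0, mul_zero]
    rw [e, hNorm2_zero]
    exact zero_le
  by_cases hFt : hNorm2 ρ α₁ α₂ F = ∞
  · rw [hFt, ENNReal.mul_top hC1, ENNReal.top_mul hG0]
    exact le_top
  by_cases hGt : hNorm2 ρ β₁ β₂ G = ∞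
  · rw [hGt, ENNReal.mul_top (mul_ne_zero hC1 hF0)]
    exact le_top
  have := hNorm2_le ρ γ₁ γ₂ _ _ (hb F G _ _ hF' hG' ENNReal.toReal_nonneg ENNReal.toReal_nonneg
    (hNorm2_bound ρ α₁ α₂ F hFt) (hNorm2_bound ρ β₁ β₂ G hGt) S hS)
  refine this.trans ?_
  rw [ENNReal.ofReal_mul (by positivity), ENNReal.ofReal_mul (by positivity), ENNReal.ofReal_toReal hFt,
    ENNReal.ofReal_toReal hGt]
  gcongr
  linarith
end
end

section
/- Resonant improvement of the bilinear paraproduct estimate (Proposition 2.6(iv)). Let α₁, α₂, β₁, β₂ ∈ ℝ∖{0} and γ₁, γ₂ ∈ ℝ satisfy γ₁ ≤ α₁ + β₁, α₁ + β₁ > 0, γ₂ ≤ min(α₂, β₂) and α₂ + β₂ > 0. Then there is a constant C, depending only on the exponents, such that for all C_b^∞ functions F, G: ℝ² → ℝ and every finite set S of pairs (M,N) of dyadic scales with M ∼ N, one has ‖Σ_{(M,N)∈S} P_M^u F · P_N^u G‖_{C_u^{γ₁}C_v^{γ₂}} ≤ C‖F‖_{C_u^{α₁}C_v^{α₂}}‖G‖_{C_u^{β₁}C_v^{β₂}}.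 -/
noncomputable section

open Real MeasureTheory
open scoped ENNReal Classical NNReal

namespace BPR

/-- Bounded continuous functions. -/
def BC {X : Type*} [TopologicalSpace X] (f : X → ℝ) : Prop :=
  Continuous f ∧ ∃ C : ℝ, 0 ≤ C ∧ ∀ x, |f x| ≤ C

/-- Symbols for which Fourier inversion is available. -/
structure Nice (g : ℝ → ℝ) : Prop where
  smooth : ContDiff ℝ (⊤ : ℕ∞) g
  supp : HasCompactSupport g
  even : ∀ ξ, g (-ξ) = g ξ

lemma integral_odd_zero {φ : ℝ → ℝ} (h : ∀ x, φ (-x) = -φ x) : ∫ x, φ x = 0 := by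
  have h1 := integral_neg_eq_self φ volume
  simp only [h, integral_neg] at h1
  linarith

lemma Nice.integrable {g : ℝ → ℝ} (hg : Nice g) : Integrable g :=
  hg.smooth.continuous.integrable_of_hasCompactSupport hg.supp

lemma invFourier_even (g : ℝ → ℝ) (x : ℝ) : invFourier g (-x) = invFourier g x := by
  simp [invFourier]

open scoped FourierTransform in
lemma kernel_props {g : ℝ → ℝ} (hg : Nice g) :
    Continuous (invFourier g) ∧ Integrable (invFourier g) ∧
      ∀ ζ, ∫ y, invFourier g y * Real.cos (y * ζ) = Real.sqrt (2 * Real.pi) * g ζ := by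
  have hc : HasCompactSupport (fun ξ => (g ξ : ℂ)) :=
    hg.supp.comp_left (g := fun x : ℝ => (x : ℂ)) (by simp)
  have hs : ContDiff ℝ (⊤ : ℕ∞) (fun ξ => (g ξ : ℂ)) :=
    Complex.ofRealCLM.contDiff.comp hg.smooth
  set T : SchwartzMap ℝ ℂ := hc.toSchwartzMap hs with hT
  have hTg : ∀ ξ, T ξ = (g ξ : ℂ) := fun ξ => rfl
  have hpi : (0:ℝ) < 2 * Real.pi := by positivity
  have hsq : Real.sqrt (2 * Real.pi) * Real.sqrt (2 * Real.pi) = 2 * Real.pi :=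
    Real.mul_self_sqrt hpi.le
  have hs0 : Real.sqrt (2 * Real.pi) ≠ 0 := by positivity
  have hF : ∀ w, (𝓕 T) w = ((∫ v, Real.cos ((2 * Real.pi * w) * v) * g v : ℝ) : ℂ) := by
    intro w
    have e : (𝓕 T) w = ∫ v : ℝ, Complex.exp (↑(-2 * Real.pi * v * w) * Complex.I) • T v := by
      rw [SchwartzMap.fourier_coe]
      exact Real.fourier_real_eq_integral_exp_smul _ _
    have hInt : Integrable (fun v : ℝ => Complex.exp (↑(-2 * Real.pi * v * w) * Complex.I) • T v) := by
      refine T.integrable.bdd_mul (c := 1) (by fun_prop) ?_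
      filter_upwards with v
      rw [Complex.norm_exp_ofReal_mul_I]
    apply Complex.ext
    · rw [e, Complex.ofReal_re]
      have := integral_re hInt
      simp only [RCLike.re_to_complex] at this
      rw [← this]
      congr 1; ext v
      rw [hTg, smul_eq_mul, Complex.re_mul_ofReal, Complex.exp_ofReal_mul_I_re, ← Real.cos_neg]
      congr 2; ring
    · rw [e, Complex.ofReal_im]
      have := integral_im hInt
      simp only [RCLike.im_to_complex] at this
      rw [← this]
      apply integral_odd_zero
      intro v
      rw [hTg, hTg, smul_eq_mul, smul_eq_mul, Complex.im_mul_ofReal, Complex.im_mul_ofReal,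
        Complex.exp_ofReal_mul_I_im, Complex.exp_ofReal_mul_I_im, hg.even, ← neg_mul, ← Real.sin_neg]
      congr 2; ring
  have hK : ∀ w, invFourier g (2 * Real.pi * w) = (Real.sqrt (2 * Real.pi))⁻¹ * ((𝓕 T) w).re := by
    intro w
    rw [hF, Complex.ofReal_re]; rfl
  have hK' : invFourier g = fun x => (Real.sqrt (2 * Real.pi))⁻¹ * ((𝓕 T) ((2 * Real.pi)⁻¹ * x)).re := by
    ext x
    rw [← hK]; congr 1; field_simp
  have hre : Integrable (fun w => ((𝓕 T) w).re) := (𝓕 T).integrable.re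
  refine ⟨?_, ?_, ?_⟩
  · rw [hK']
    have := (𝓕 T).continuous
    fun_prop
  · rw [hK']
    exact (hre.comp_mul_left' (by positivity)).const_mul _
  · intro ζ
    have inv : 𝓕⁻ (𝓕 T) = T := FourierPair.fourierInv_fourier_eq T
    have e : T ζ = ∫ v : ℝ, Complex.exp (((2 * Real.pi * inner ℝ v ζ : ℝ) : ℂ) * Complex.I) • (𝓕 T) v := by
      conv_lhs => rw [← inv]
      rw [SchwartzMap.fourierInv_coe]
      exact Real.fourierInv_eq' _ _
    have hInt : Integrable (fun v : ℝ => Complex.exp (((2 * Real.pi * inner ℝ v ζ : ℝ) : ℂ) * Complex.I) • (𝓕 T) v) := by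
      refine (𝓕 T).integrable.bdd_mul (c := 1) (by fun_prop) ?_
      filter_upwards with v
      rw [Complex.norm_exp_ofReal_mul_I]
    have h2 := integral_re hInt
    simp only [RCLike.re_to_complex] at h2
    rw [← e, hTg, Complex.ofReal_re] at h2
    have h3 : ∀ v : ℝ, (Complex.exp (((2 * Real.pi * inner ℝ v ζ : ℝ) : ℂ) * Complex.I) • (𝓕 T) v).re
        = Real.sqrt (2 * Real.pi) * (invFourier g (2 * Real.pi * v) * Real.cos ((2 * Real.pi * v) * ζ)) := by
      intro v
      have him : ((𝓕 T) v).im = 0 := by rw [hF]; exact Complex.ofReal_im _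
      rw [hK, smul_eq_mul, Complex.mul_re, him, Complex.exp_ofReal_mul_I_re]
      have : inner ℝ v ζ = v * ζ := by simp [mul_comm]
      rw [this]
      field_simp
      ring_nf
    simp only [h3] at h2
    rw [integral_const_mul, Measure.integral_comp_mul_left
      (fun y => invFourier g y * Real.cos (y * ζ)), abs_of_pos (by positivity), smul_eq_mul] at h2
    rw [← h2]
    set I := ∫ y, invFourier g y * Real.cos (y * ζ)
    have : Real.sqrt (2 * Real.pi) * (Real.sqrt (2 * Real.pi) * ((2 * Real.pi)⁻¹ * I))
      = (Real.sqrt (2 * Real.pi) * Real.sqrt (2 * Real.pi)) * (2 * Real.pi)⁻¹ * I := by ring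
    rw [this, hsq]; field_simp

lemma kernel_sin {g : ℝ → ℝ} (ζ : ℝ) : ∫ y, invFourier g y * Real.sin (y * ζ) = 0 := by
  apply integral_odd_zero
  intro y
  rw [invFourier_even, neg_mul, Real.sin_neg]; ring

lemma invFourier_scale (g : ℝ → ℝ) {l : ℝ} (hl : 0 < l) (x : ℝ) :
    invFourier (fun ξ => g (ξ / l)) x = l * invFourier g (l * x) := by
  unfold invFourier
  have h := Measure.integral_comp_mul_left (fun ξ => Real.cos (l * x * ξ) * g ξ) l⁻¹
  have e : ∀ ξ, Real.cos (l * x * (l⁻¹ * ξ)) * g (l⁻¹ * ξ) = Real.cos (x * ξ) * g (ξ / l) := by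
    intro ξ
    congr 2
    · field_simp
    · field_simp
  simp only [e] at h
  rw [h, inv_inv, abs_of_pos hl, smul_eq_mul]; ring

lemma integral_abs_scale (φ : ℝ → ℝ) {l : ℝ} (hl : 0 < l) :
    ∫ x, |l * φ (l * x)| = ∫ x, |φ x| := by
  have h := Measure.integral_comp_mul_left (fun x => |φ x|) l
  simp only [abs_mul, abs_of_pos hl]
  rw [integral_const_mul, h, abs_of_pos (by positivity), smul_eq_mul]
  field_simp

lemma Nice.scale {g : ℝ → ℝ} (hg : Nice g) {l : ℝ} (hl : 0 < l) : Nice (fun ξ => g (ξ / l)) where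
  smooth := hg.smooth.comp (contDiff_id.div_const l)
  supp := by
    have := hg.supp.comp_homeomorph (Homeomorph.mulLeft₀ l⁻¹ (by positivity))
    convert this using 1
    ext ξ
    simp [div_eq_inv_mul]
  even := fun ξ => by rw [neg_div, hg.even]

lemma Nice.sub {g h : ℝ → ℝ} (hg : Nice g) (hh : Nice h) : Nice (fun ξ => g ξ - h ξ) where
  smooth := hg.smooth.sub hh.smooth
  supp := hg.supp.sub hh.supp
  even := fun ξ => by rw [hg.even, hh.even]

lemma nice_rho {ρ : ℝ → ℝ} (hρ : IsLPCutoff ρ) : Nice ρ where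
  smooth := hρ.smooth
  supp := HasCompactSupport.intro (isCompact_Icc (a := -(9/8:ℝ)) (b := 9/8)) (by
    intro x hx
    apply hρ.eq_zero
    by_contra h
    push Not at h
    exact hx ⟨(abs_lt.1 h).1.le, (abs_lt.1 h).2.le⟩)
  even := hρ.even

lemma nice_symbol {ρ : ℝ → ℝ} (hρ : IsLPCutoff ρ) (k : ℕ) : Nice (lpSymbol ρ k) := by
  cases k with
  | zero => exact nice_rho hρ
  | succ k =>
    have h1 := (nice_rho hρ).scale (l := 2 ^ (k+1)) (by positivity)
    have h2 := (nice_rho hρ).scale (l := 2 ^ (k+1) / 2) (by positivity)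
    have := h1.sub h2
    refine (show lpSymbol ρ (k+1) = _ from ?_) ▸ this
    ext ξ
    simp only [lpSymbol]
    congr 2
    field_simp

lemma lpKernel_cont {ρ : ℝ → ℝ} (hρ : IsLPCutoff ρ) (k : ℕ) : Continuous (lpKernel ρ k) :=
  (kernel_props (nice_symbol hρ k)).1

lemma lpKernel_int {ρ : ℝ → ℝ} (hρ : IsLPCutoff ρ) (k : ℕ) : Integrable (lpKernel ρ k) :=
  (kernel_props (nice_symbol hρ k)).2.1

lemma lpKernel_L1 {ρ : ℝ → ℝ} (_hρ : IsLPCutoff ρ) :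
    ∃ C₀ : ℝ, 0 < C₀ ∧ ∀ k, ∫ y, |lpKernel ρ k y| ≤ C₀ := by
  set ψ : ℝ → ℝ := fun ξ => ρ ξ - ρ (2 * ξ) with hψ
  have h1 : 0 ≤ ∫ y, |lpKernel ρ 0 y| := integral_nonneg fun _ => abs_nonneg _
  have h2 : 0 ≤ ∫ y, |invFourier ψ y| := integral_nonneg fun _ => abs_nonneg _
  refine ⟨(∫ y, |lpKernel ρ 0 y|) + (∫ y, |invFourier ψ y|) + 1, by linarith, ?_⟩
  intro k
  cases k with
  | zero => linarith
  | succ k =>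
    have e : lpKernel ρ (k+1) = fun x => 2 ^ (k+1) * invFourier ψ (2 ^ (k+1) * x) := by
      ext x
      rw [← invFourier_scale ψ (by positivity)]
      unfold lpKernel
      congr 1; ext ξ
      simp only [lpSymbol, hψ]
      congr 2; ring
    rw [e, integral_abs_scale _ (by positivity)]
    linarith

lemma sum_lpSymbol (ρ : ℝ → ℝ) (n : ℕ) (ξ : ℝ) :
    ∑ k ∈ Finset.range (n+1), lpSymbol ρ k ξ = ρ (ξ / 2 ^ n) := by
  induction n with
  | zero => simp [lpSymbol]
  | succ n ih =>
    rw [Finset.sum_range_succ, ih]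
    simp only [lpSymbol]
    have : 2 * ξ / 2 ^ (n+1) = ξ / 2 ^ n := by rw [pow_succ]; field_simp
    rw [this]; ring

lemma sum_lpKernel {ρ : ℝ → ℝ} (hρ : IsLPCutoff ρ) (n : ℕ) (x : ℝ) :
    ∑ k ∈ Finset.range (n+1), lpKernel ρ k x = 2 ^ n * invFourier ρ (2 ^ n * x) := by
  rw [← invFourier_scale ρ (by positivity)]
  simp only [lpKernel, invFourier, ← Finset.mul_sum, ← sum_lpSymbol]
  congr 1
  rw [← integral_finsetSum]
  · simp only [Finset.mul_sum]
  · intro i _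
    refine (nice_symbol hρ i).integrable.bdd_mul (c := 1) (by fun_prop) ?_
    filter_upwards with v
    exact Real.abs_cos_le_one _

lemma BC.mul {X : Type*} [TopologicalSpace X] {f g : X → ℝ} (hf : BC f) (hg : BC g) :
    BC (fun x => f x * g x) := by
  obtain ⟨hfc, C, hC, hfb⟩ := hf
  obtain ⟨hgc, D, hD, hgb⟩ := hg
  refine ⟨hfc.mul hgc, C * D, by positivity, fun x => ?_⟩
  rw [abs_mul]
  exact mul_le_mul (hfb x) (hgb x) (abs_nonneg _) hC

lemma BC.sum {X : Type*} [TopologicalSpace X] {ι : Type*} (S : Finset ι) {f : ι → X → ℝ}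
    (hf : ∀ i, BC (f i)) : BC (fun x => ∑ i ∈ S, f i x) := by
  choose hc C hC hb using hf
  refine ⟨continuous_finsetSum _ fun i _ => hc i, ∑ i ∈ S, C i,
    Finset.sum_nonneg fun i _ => hC i, fun x => ?_⟩
  exact (Finset.abs_sum_le_sum_abs _ _).trans (Finset.sum_le_sum fun i _ => hb i x)

lemma BC.comp {X Y : Type*} [TopologicalSpace X] [TopologicalSpace Y] {f : Y → ℝ} (hf : BC f)
    {h : X → Y} (hh : Continuous h) : BC (fun x => f (h x)) :=
  ⟨hf.1.comp hh, hf.2.choose, hf.2.choose_spec.1, fun _ => hf.2.choose_spec.2 _⟩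

lemma BC.integrable_mul {K f : ℝ → ℝ} (hK : Integrable K) (hf : BC f) :
    Integrable (fun y => K y * f y) := by
  obtain ⟨hc, C, hC, hb⟩ := hf
  exact hK.mul_bdd (c := C) hc.aestronglyMeasurable (Filter.Eventually.of_forall hb)

lemma abs_integral_le {K f : ℝ → ℝ} (hK : Integrable K) {C : ℝ} (hb : ∀ y, |f y| ≤ C) :
    |∫ y, K y * f y| ≤ (∫ y, |K y|) * C := by
  rw [← integral_mul_const, ← Real.norm_eq_abs]
  refine norm_integral_le_of_norm_le (hK.abs.mul_const C) (Filter.Eventually.of_forall fun y => ?_)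
  rw [Real.norm_eq_abs, abs_mul]
  exact mul_le_mul_of_nonneg_left (hb y) (abs_nonneg _)

lemma BC.param {X : Type*} [TopologicalSpace X] [FirstCountableTopology X] {K : ℝ → ℝ}
    (hK : Integrable K) {Φ : X × ℝ → ℝ} (hΦ : BC Φ) : BC (fun x => ∫ y, K y * Φ (x, y)) := by
  obtain ⟨hc, C, hC, hb⟩ := hΦ
  refine ⟨?_, (∫ y, |K y|) * C, ?_, fun x => abs_integral_le hK fun y => hb _⟩
  · refine continuous_of_dominated (bound := fun y => |K y| * C) ?_ ?_ (hK.abs.mul_const C) ?_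
    · intro x
      have : Continuous fun y => Φ (x, y) := by fun_prop
      exact hK.aestronglyMeasurable.mul this.aestronglyMeasurable
    · intro x
      filter_upwards with y
      rw [Real.norm_eq_abs, abs_mul]
      exact mul_le_mul_of_nonneg_left (hb _) (abs_nonneg _)
    · filter_upwards with y
      fun_prop
  · exact mul_nonneg (integral_nonneg fun _ => abs_nonneg _) hC

lemma swap_bdd {Q R : ℝ → ℝ} (hQ : Integrable Q) (hR : Integrable R) {Φ : ℝ × ℝ → ℝ}
    (hΦ : BC Φ) :
    ∫ y, Q y * ∫ a, R a * Φ (y, a) = ∫ a, R a * ∫ y, Q y * Φ (y, a) := by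
  obtain ⟨hc, C, hC, hb⟩ := hΦ
  have h := (hQ.mul_prod hR).mul_bdd (c := C) hc.aestronglyMeasurable (Filter.Eventually.of_forall hb)
  simp only [← integral_const_mul]
  have e := integral_integral_swap (f := fun y a => Q y * (R a * Φ (y, a))) (μ := volume)
    (ν := volume) (by simpa [Function.uncurry_def, mul_assoc] using h)
  rw [e]
  congr 1; ext a; congr 1; ext y; ring

lemma swap_conv {Q A f : ℝ → ℝ} (hQ : Integrable Q) (hA : Integrable A) (hf : BC f) :
    ∫ y, Q y * ∫ z, A (z - y) * f z = ∫ z, f z * ∫ y, Q y * A (z - y) := by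
  obtain ⟨hc, C, hC, hb⟩ := hf
  have h0 := Integrable.convolution_integrand (ContinuousLinearMap.mul ℝ ℝ) hQ hA
    (μ := volume) (ν := volume)
  have h := h0.mul_bdd (c := C) (hc.comp continuous_fst).aestronglyMeasurable
    (Filter.Eventually.of_forall fun p => hb p.1)
  simp only [← integral_const_mul]
  have e := integral_integral_swap (f := fun z y => f z * (Q y * A (z - y))) (μ := volume)
    (ν := volume) (by
      refine h.congr (Filter.Eventually.of_forall fun p => ?_)
      simp [Function.uncurry_def]; ring)
  rw [e]
  congr 1; ext a; congr 1; ext y; ring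

lemma invFourier_BC {B : ℝ → ℝ} (hB : Nice B) : BC (invFourier B) := by
  set s := (Real.sqrt (2 * Real.pi))⁻¹ with hs
  refine ⟨(kernel_props hB).1, s * ((∫ b, |B b|) * 1), ?_, fun x => ?_⟩
  · have : 0 ≤ ∫ b, |B b| := integral_nonneg fun _ => abs_nonneg _
    positivity
  · simp only [invFourier, mul_comm (Real.cos _)]
    rw [abs_mul, abs_of_nonneg (by positivity : 0 ≤ s)]
    exact mul_le_mul_of_nonneg_left
      (abs_integral_le hB.integrable fun y => Real.abs_cos_le_one _) (by positivity)

/-- The triple kernel vanishes when frequencies do not interact. -/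
lemma triple_kernel {K A B : ℝ → ℝ} (hK : Nice K) (hA : Nice A) (hB : Nice B)
    (h0 : ∀ s t, A s * B t * K (s + t) = 0) (z w : ℝ) :
    ∫ y, invFourier K y * invFourier A (z - y) * invFourier B (w - y) = 0 := by
  obtain ⟨hKc, hKi, hKf⟩ := kernel_props hK
  obtain ⟨hAc, hAi, hAf⟩ := kernel_props hA
  obtain ⟨hBc, hBi, hBf⟩ := kernel_props hB
  set s := (Real.sqrt (2 * Real.pi))⁻¹ with hs
  have hcos : ∀ z : ℝ, BC (fun p : ℝ × ℝ => Real.cos ((z - p.1) * p.2)) := fun z =>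
    ⟨by fun_prop, 1, zero_le_one, fun x => Real.abs_cos_le_one _⟩
  have hcos1 : ∀ z a : ℝ, BC (fun y : ℝ => Real.cos ((z - y) * a)) := fun z a =>
    ⟨by fun_prop, 1, zero_le_one, fun x => Real.abs_cos_le_one _⟩
  have hinv : ∀ (g : ℝ → ℝ) (x : ℝ), invFourier g x = s * ∫ a, g a * Real.cos (x * a) := by
    intro g x
    simp only [invFourier, mul_comm (Real.cos _), hs]
  have hBbc : BC (invFourier B) := invFourier_BC hB
  have hBw : BC (fun y => invFourier B (w - y)) := hBbc.comp (by fun_prop)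
  have hKB : Integrable (fun y => invFourier K y * invFourier B (w - y)) := hBw.integrable_mul hKi
  -- the innermost integral
  have inner : ∀ a b, A a * (B b * ∫ y, invFourier K y * (Real.cos ((z - y) * a) * Real.cos ((w - y) * b))) = 0 := by
    intro a b
    have key : ∀ θ ζ : ℝ, ∫ y, invFourier K y * Real.cos (θ - y * ζ) =
        Real.cos θ * (Real.sqrt (2 * Real.pi) * K ζ) := by
      intro θ ζ
      rw [← hKf ζ, ← integral_const_mul]
      have h1 : Integrable (fun y => invFourier K y * Real.cos (y * ζ)) :=
        BC.integrable_mul hKi ⟨by fun_prop, 1, zero_le_one, fun x => Real.abs_cos_le_one _⟩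
      have h2 : Integrable (fun y => invFourier K y * Real.sin (y * ζ)) :=
        BC.integrable_mul hKi ⟨by fun_prop, 1, zero_le_one, fun x => Real.abs_sin_le_one _⟩
      have e : ∀ y, invFourier K y * Real.cos (θ - y * ζ) =
          Real.cos θ * (invFourier K y * Real.cos (y * ζ)) +
          Real.sin θ * (invFourier K y * Real.sin (y * ζ)) := by
        intro y; rw [Real.cos_sub]; ring
      simp only [e]
      rw [integral_add (h1.const_mul _) (h2.const_mul _), integral_const_mul (Real.sin θ),
        kernel_sin]
      ring
    have hi : ∀ θ ζ : ℝ, Integrable (fun y => invFourier K y * Real.cos (θ - y * ζ)) := fun θ ζ =>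
      BC.integrable_mul hKi ⟨by fun_prop, 1, zero_le_one, fun x => Real.abs_cos_le_one _⟩
    have e : ∀ y, invFourier K y * (Real.cos ((z - y) * a) * Real.cos ((w - y) * b)) =
        (1/2) * (invFourier K y * Real.cos ((z * a + w * b) - y * (a + b))) +
        (1/2) * (invFourier K y * Real.cos ((z * a - w * b) - y * (a + -b))) := by
      intro y
      have e1 : (z * a + w * b) - y * (a + b) = (z - y) * a + (w - y) * b := by ring
      have e2 : (z * a - w * b) - y * (a + -b) = (z - y) * a - (w - y) * b := by ring
      rw [e1, e2, Real.cos_add, Real.cos_sub]; ring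
    simp only [e]
    rw [integral_add ((hi _ _).const_mul _) ((hi _ _).const_mul _), integral_const_mul,
      integral_const_mul, key, key]
    have q1 := h0 a b
    have q2 := h0 a (-b)
    rw [hB.even] at q2
    linear_combination (1/2) * (Real.cos (z * a + w * b) * Real.sqrt (2 * Real.pi)) * q1 +
      (1/2) * (Real.cos (z * a - w * b) * Real.sqrt (2 * Real.pi)) * q2
  have step1 : ∀ a, A a * ∫ y, (invFourier K y * invFourier B (w - y)) * Real.cos ((z - y) * a) = 0 := by
    intro a
    have hKc' : Integrable (fun y => invFourier K y * Real.cos ((z - y) * a)) :=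
      (hcos1 z a).integrable_mul hKi
    have e : ∀ y, (invFourier K y * invFourier B (w - y)) * Real.cos ((z - y) * a) =
        s * ((invFourier K y * Real.cos ((z - y) * a)) * ∫ b, B b * Real.cos ((w - y) * b)) := by
      intro y
      rw [hinv B]; ring
    simp only [e]
    rw [integral_const_mul, swap_bdd hKc' hB.integrable (hcos w), mul_left_comm,
      ← integral_const_mul]
    have : ∀ b, A a * (B b * ∫ y, invFourier K y * Real.cos ((z - y) * a) * Real.cos ((w - y) * b)) = 0 := by
      intro b
      rw [← inner a b]
      simp only [mul_assoc]
    simp [this]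
  have e : ∀ y, invFourier K y * invFourier A (z - y) * invFourier B (w - y) =
      s * ((invFourier K y * invFourier B (w - y)) * ∫ a, A a * Real.cos ((z - y) * a)) := by
    intro y
    rw [hinv A]; ring
  simp only [e]
  rw [integral_const_mul, swap_bdd hKB hA.integrable (hcos z)]
  simp [step1]

lemma LP_BC {ρ : ℝ → ℝ} (hρ : IsLPCutoff ρ) (k : ℕ) {f : ℝ → ℝ} (hf : BC f) : BC (LP ρ k f) :=
  BC.param (lpKernel_int hρ k) (Φ := fun q => f (q.1 - q.2)) (hf.comp (by fun_prop))

lemma LPu_BC {ρ : ℝ → ℝ} (hρ : IsLPCutoff ρ) (k : ℕ) {F : ℝ × ℝ → ℝ} (hf : BC F) :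
    BC (LPu ρ k F) :=
  BC.param (lpKernel_int hρ k) (Φ := fun q : (ℝ × ℝ) × ℝ => F (q.1.1 - q.2, q.1.2))
    (hf.comp (by fun_prop))

lemma LPv_BC {ρ : ℝ → ℝ} (hρ : IsLPCutoff ρ) (k : ℕ) {F : ℝ × ℝ → ℝ} (hf : BC F) :
    BC (LPv ρ k F) :=
  BC.param (lpKernel_int hρ k) (Φ := fun q : (ℝ × ℝ) × ℝ => F (q.1.1, q.1.2 - q.2))
    (hf.comp (by fun_prop))

lemma LPu_LPv {ρ : ℝ → ℝ} (hρ : IsLPCutoff ρ) (k l : ℕ) {F : ℝ × ℝ → ℝ} (hf : BC F) :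
    LPu ρ k (LPv ρ l F) = LPv ρ l (LPu ρ k F) := by
  ext p
  exact swap_bdd (lpKernel_int hρ k) (lpKernel_int hρ l)
    (Φ := fun q => F (p.1 - q.1, p.2 - q.2)) (hf.comp (by fun_prop))

lemma LP_triple_zero {ρ : ℝ → ℝ} (hρ : IsLPCutoff ρ) {k a b : ℕ} {f g : ℝ → ℝ} (hf : BC f)
    (hg : BC g) (h0 : ∀ s t, lpSymbol ρ a s * lpSymbol ρ b t * lpSymbol ρ k (s + t) = 0) (x : ℝ) :
    LP ρ k (fun y => LP ρ a f y * LP ρ b g y) x = 0 := by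
  have hA := lpKernel_int hρ a
  have hB := lpKernel_int hρ b
  have hK := lpKernel_int hρ k
  have e : ∀ (c : ℕ) (f : ℝ → ℝ) (y : ℝ), LP ρ c f (x - y) = ∫ z, lpKernel ρ c (z - y) * f (x - z) := by
    intro c f y
    have h := integral_sub_right_eq_self (fun t => lpKernel ρ c t * f (x - y - t)) (μ := volume) y
    unfold LP
    rw [← h]
    congr 1; ext z; congr 2; ring
  have hB' : BC (fun y => LP ρ b g (x - y)) := (LP_BC hρ b hg).comp (by fun_prop)
  have hf' : BC (fun z => f (x - z)) := hf.comp (by fun_prop)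
  have hg' : BC (fun z => g (x - z)) := hg.comp (by fun_prop)
  have s1 : LP ρ k (fun y => LP ρ a f y * LP ρ b g y) x =
      ∫ y, (lpKernel ρ k y * LP ρ b g (x - y)) * ∫ z, lpKernel ρ a (z - y) * f (x - z) := by
    unfold LP
    congr 1; ext y
    have := e a f y
    unfold LP at this
    rw [← this]; ring
  rw [s1, swap_conv (hB'.integrable_mul hK) hA hf']
  have s2 : ∀ z, ∫ y, lpKernel ρ k y * LP ρ b g (x - y) * lpKernel ρ a (z - y) = 0 := by
    intro z
    have hAb : BC (fun y => lpKernel ρ a (z - y)) :=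
      (invFourier_BC (nice_symbol hρ a)).comp (by fun_prop)
    have : ∀ y, lpKernel ρ k y * LP ρ b g (x - y) * lpKernel ρ a (z - y) =
      (lpKernel ρ k y * lpKernel ρ a (z - y)) * ∫ w, lpKernel ρ b (w - y) * g (x - w) := by
      intro y
      rw [e b g y]; ring
    simp only [this]
    rw [swap_conv (hAb.integrable_mul hK) hB hg']
    have : ∀ w, ∫ y, lpKernel ρ k y * lpKernel ρ a (z - y) * lpKernel ρ b (w - y) = 0 := fun w =>
      triple_kernel (nice_symbol hρ k) (nice_symbol hρ a) (nice_symbol hρ b) h0 z w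
    simp [this]
  simp [s2]

/-- Reconstruction: the partial sums converge. -/
lemma LP_sum {ρ : ℝ → ℝ} (hρ : IsLPCutoff ρ) (n : ℕ) {f : ℝ → ℝ} (hf : BC f) (x : ℝ) :
    ∑ k ∈ Finset.range (n+1), LP ρ k f x = ∫ z, invFourier ρ z * f (x - z / 2 ^ n) := by
  have hf' : BC (fun y => f (x - y)) := hf.comp (by fun_prop)
  unfold LP
  rw [← integral_finsetSum _ (fun i _ => hf'.integrable_mul (lpKernel_int hρ i))]
  simp only [← Finset.sum_mul, sum_lpKernel hρ]
  have h := Measure.integral_comp_mul_left (fun z => invFourier ρ z * f (x - z / 2 ^ n)) (2 ^ n)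
  have e : ∀ y : ℝ, x - 2 ^ n * y / 2 ^ n = x - y := by intro y; field_simp
  simp only [e] at h
  simp only [mul_assoc]
  rw [integral_const_mul, h, abs_of_pos (by positivity), smul_eq_mul]
  field_simp

lemma LP_tendsto {ρ : ℝ → ℝ} (hρ : IsLPCutoff ρ) {f : ℝ → ℝ} (hf : BC f) (x : ℝ) :
    Filter.Tendsto (fun n : ℕ => ∑ k ∈ Finset.range (n+1), LP ρ k f x) Filter.atTop
      (nhds (Real.sqrt (2 * Real.pi) * f x)) := by
  obtain ⟨hc, hi, hfi⟩ := kernel_props (nice_rho hρ)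
  have h1 := hfi 0
  simp only [mul_zero, Real.cos_zero, mul_one, hρ.eq_one 0 (by norm_num)] at h1
  rw [← h1, ← integral_mul_const]
  simp only [LP_sum hρ _ hf]
  obtain ⟨hfc, C, hC, hb⟩ := hf
  refine tendsto_integral_of_dominated_convergence (fun y => |invFourier ρ y| * C) ?_
    (hi.abs.mul_const C) ?_ ?_
  · intro n
    exact (hc.mul (by fun_prop)).aestronglyMeasurable
  · intro n
    filter_upwards with y
    rw [Real.norm_eq_abs, abs_mul]
    exact mul_le_mul_of_nonneg_left (hb _) (abs_nonneg _)
  · filter_upwards with y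
    refine Filter.Tendsto.const_mul _ ?_
    have : Filter.Tendsto (fun n : ℕ => x - y / 2 ^ n) Filter.atTop (nhds (x - 0)) := by
      refine tendsto_const_nhds.sub ?_
      exact tendsto_const_nhds.div_atTop (tendsto_pow_atTop_atTop_of_one_lt (by norm_num))
    rw [sub_zero] at this
    exact (hfc.tendsto x).comp this

lemma LP_sum_bound {ρ : ℝ → ℝ} (hρ : IsLPCutoff ρ) {f : ℝ → ℝ} (hf : BC f) :
    ∃ D : ℝ, 0 ≤ D ∧ ∀ (n : ℕ) x, |∑ k ∈ Finset.range (n+1), LP ρ k f x| ≤ D := by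
  obtain ⟨hc, hi, hfi⟩ := kernel_props (nice_rho hρ)
  have hf0 := hf
  obtain ⟨hfc, C, hC, hb⟩ := hf
  refine ⟨(∫ y, |invFourier ρ y|) * C, mul_nonneg (integral_nonneg fun _ => abs_nonneg _) hC,
    fun n x => ?_⟩
  rw [LP_sum hρ _ hf0]
  exact abs_integral_le hi fun y => hb _

lemma symb_supp {ρ : ℝ → ℝ} (hρ : IsLPCutoff ρ) {k : ℕ} {ξ : ℝ} (h : lpSymbol ρ k ξ ≠ 0) :
    |ξ| < 9/8 * 2 ^ k ∧ (k = 0 ∨ 7/16 * 2 ^ k < |ξ|) := by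
  cases k with
  | zero =>
    refine ⟨?_, Or.inl rfl⟩
    by_contra hc
    push Not at hc
    exact h (hρ.eq_zero ξ (by simpa using hc))
  | succ k =>
    have hp : (0:ℝ) < 2 ^ (k+1) := by positivity
    refine ⟨?_, Or.inr ?_⟩
    · by_contra hc
      push Not at hc
      apply h
      simp only [lpSymbol]
      rw [hρ.eq_zero, hρ.eq_zero, sub_zero]
      · rw [abs_div, abs_mul, abs_of_pos hp, le_div_iff₀ hp, abs_two]; nlinarith [abs_nonneg ξ]
      · rw [abs_div, abs_of_pos hp, le_div_iff₀ hp]; exact hc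
    · by_contra hc
      push Not at hc
      apply h
      simp only [lpSymbol]
      rw [hρ.eq_one, hρ.eq_one, sub_self]
      · rw [abs_div, abs_mul, abs_of_pos hp, div_le_iff₀ hp, abs_two]; linarith
      · rw [abs_div, abs_of_pos hp, div_le_iff₀ hp]; linarith [abs_nonneg ξ]

/-- Admissible frequency triples. -/
def Adm (k a b : ℕ) : Prop :=
  k ≤ max a b + 3 ∧ (b ≤ a + 3 ∨ b ≤ k + 3) ∧ (a ≤ b + 3 ∨ a ≤ k + 3)

lemma pow16 {a b : ℕ} (h : a + 4 ≤ b) : (2:ℝ) ^ a * 16 ≤ 2 ^ b := by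
  have : (2:ℝ) ^ (a + 4) ≤ 2 ^ b := pow_le_pow_right₀ (by norm_num) h
  rw [pow_add] at this
  linarith

lemma not_adm {ρ : ℝ → ℝ} (hρ : IsLPCutoff ρ) {k a b : ℕ} (h : ¬ Adm k a b) (s t : ℝ) :
    lpSymbol ρ a s * lpSymbol ρ b t * lpSymbol ρ k (s + t) = 0 := by
  by_contra hne
  simp only [mul_eq_zero, not_or] at hne
  obtain ⟨⟨h1, h2⟩, h3⟩ := hne
  obtain ⟨a1, a2⟩ := symb_supp hρ h1
  obtain ⟨b1, b2⟩ := symb_supp hρ h2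
  obtain ⟨k1, k2⟩ := symb_supp hρ h3
  have t1 := abs_add_le s t
  have t2 : |s| ≤ |s + t| + |t| := by
    have := abs_sub (s + t) t; rwa [add_sub_cancel_right] at this
  have t3 : |t| ≤ |s + t| + |s| := by
    have := abs_sub (s + t) s; rwa [add_sub_cancel_left] at this
  have pa : (0:ℝ) < 2 ^ a := by positivity
  have pb : (0:ℝ) < 2 ^ b := by positivity
  have pk : (0:ℝ) < 2 ^ k := by positivity
  unfold Adm at h
  have : (a + 4 ≤ k ∧ b + 4 ≤ k) ∨ (a + 4 ≤ b ∧ k + 4 ≤ b) ∨ (b + 4 ≤ a ∧ k + 4 ≤ a) := by omega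
  rcases this with ⟨p, q⟩ | ⟨p, q⟩ | ⟨p, q⟩
  · have := pow16 p; have := pow16 q
    rcases k2 with k2 | k2
    · omega
    · linarith
  · have := pow16 p; have := pow16 q
    rcases b2 with k2 | k2
    · omega
    · linarith
  · have := pow16 p; have := pow16 q
    rcases a2 with k2 | k2
    · omega
    · linarith

/-- Dyadic weight. -/
def w (α : ℝ) (a : ℕ) : ℝ := (2:ℝ) ^ (-α * a)

/-- Decay weight. -/
def ee (δ x : ℝ) : ℝ := (2:ℝ) ^ (-δ * |x|)

lemma w_pos (α : ℝ) (a : ℕ) : 0 < w α a := by unfold w; positivity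
lemma ee_pos (δ x : ℝ) : 0 < ee δ x := by unfold ee; positivity

lemma ee_sum {δ : ℝ} (hδ : 0 < δ) : ∃ D : ℝ, 0 ≤ D ∧ ∀ (T : Finset ℕ) (k : ℕ),
    ∑ j ∈ T, ee δ ((j:ℝ) - k) ≤ D := by
  have hs : Summable (fun n : ℕ => ee δ (n:ℝ)) := by
    have : (fun n : ℕ => ee δ (n:ℝ)) = fun n : ℕ => ((2:ℝ) ^ (-δ)) ^ n := by
      ext n
      unfold ee
      rw [Nat.abs_cast, Real.rpow_mul (by norm_num), Real.rpow_natCast]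
    rw [this]
    exact summable_geometric_of_lt_one (by positivity)
      (Real.rpow_lt_one_of_one_lt_of_neg (by norm_num) (by linarith))
  have hz : Summable (fun m : ℤ => ee δ (m:ℝ)) := by
    apply Summable.of_nat_of_neg
    · simpa using hs
    · have : ∀ n : ℕ, ee δ (((-(n:ℤ)) : ℤ) : ℝ) = ee δ (n:ℝ) := by
        intro n; unfold ee; push_cast; rw [abs_neg]
      simpa only [this] using hs
  refine ⟨∑' m : ℤ, ee δ (m:ℝ), tsum_nonneg fun _ => (ee_pos _ _).le, fun T k => ?_⟩
  have : ∑ j ∈ T, ee δ ((j:ℝ) - k) = ∑ m ∈ T.image (fun j : ℕ => (j:ℤ) - k), ee δ (m:ℝ) := by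
    rw [Finset.sum_image]
    · push_cast; rfl
    · intro x _ y _ h
      simp only at h
      omega
  rw [this]
  exact hz.sum_le_tsum _ fun _ _ => (ee_pos _ _).le

lemma double_sum {D : ℝ} (hD : 0 ≤ D) {u : ℕ → ℝ} {v : ℕ → ℕ → ℝ} (hu : ∀ a, 0 ≤ u a)
    (hv : ∀ a b, 0 ≤ v a b) (h1 : ∀ T : Finset ℕ, ∑ a ∈ T, u a ≤ D)
    (h2 : ∀ a (T : Finset ℕ), ∑ b ∈ T, v a b ≤ D) (S : Finset (ℕ × ℕ)) :
    ∑ q ∈ S, u q.1 * v q.1 q.2 ≤ D * D := by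
  calc ∑ q ∈ S, u q.1 * v q.1 q.2
      ≤ ∑ q ∈ S.image Prod.fst ×ˢ S.image Prod.snd, u q.1 * v q.1 q.2 :=
        Finset.sum_le_sum_of_subset_of_nonneg Finset.subset_product
          fun q _ _ => mul_nonneg (hu _) (hv _ _)
    _ = ∑ a ∈ S.image Prod.fst, u a * ∑ b ∈ S.image Prod.snd, v a b := by
        rw [Finset.sum_product]; simp only [Finset.mul_sum]
    _ ≤ ∑ a ∈ S.image Prod.fst, u a * D :=
        Finset.sum_le_sum fun a _ => mul_le_mul_of_nonneg_left (h2 _ _) (hu a)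
    _ ≤ D * D := by
        rw [← Finset.sum_mul]
        exact mul_le_mul_of_nonneg_right (h1 _) hD

lemma ee_symm (δ x y : ℝ) : ee δ (x - y) = ee δ (y - x) := by
  unfold ee; rw [abs_sub_comm]

lemma res_exp {α β γ δ g a b k : ℝ} (hδ : 0 < δ) (hδ' : δ ≤ α + β) (hγ : γ ≤ α + β)
    (hk : 0 ≤ k) (hab : |a - b| ≤ g) (hka : k ≤ a + g) :
    -α * a + -β * b ≤ (|β| * g + 3 * ((α + β) * g)) + -γ * k + (-δ * |a - k| + -δ * |a - b|) := by
  have hg : 0 ≤ g := (abs_nonneg _).trans hab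
  have h1 : β * (a - b) ≤ |β| * g :=
    (le_abs_self _).trans (by rw [abs_mul]; exact mul_le_mul_of_nonneg_left hab (abs_nonneg _))
  have h2 : δ * |a - b| ≤ (α + β) * g :=
    mul_le_mul hδ' hab (abs_nonneg _) (by linarith)
  have h3 : γ * k ≤ (α + β) * k := mul_le_mul_of_nonneg_right hγ hk
  have h5 : 0 ≤ (α + β) * g := mul_nonneg (by linarith) hg
  have h4 : δ * |a - k| ≤ (α + β) * (a - k) + 2 * ((α + β) * g) := by
    rcases le_total k a with h | h
    · rw [abs_of_nonneg (by linarith)]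
      have := mul_le_mul_of_nonneg_right hδ' (by linarith : 0 ≤ a - k)
      linarith
    · rw [abs_of_nonpos (by linarith)]
      have := mul_le_mul_of_nonneg_right hδ' (by linarith : 0 ≤ k - a)
      have := mul_le_mul_of_nonneg_left (by linarith : k - a ≤ g) (by linarith : 0 ≤ α + β)
      linarith
  linarith

lemma low_exp {α β γ δ g a b k : ℝ} (hδ : 0 < δ) (hδα : δ ≤ |α|)
    (hγ : γ ≤ min α β) (hab : 0 < α + β)
    (hk : 0 ≤ k) (ha : 0 ≤ a) (hbk : |b - k| ≤ g) (hak : a ≤ k + g) :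
    -α * a + -β * b ≤ ((|β| + 3 * |α|) * g) + -γ * k + (-δ * |a| + -δ * |b - k|) ∨
    -α * a + -β * b ≤ ((|β| + 3 * |α|) * g) + -γ * k + (-δ * |a - k| + -δ * |b - k|) := by
  have hg : 0 ≤ g := (abs_nonneg _).trans hbk
  have h1 : -(β * (b - k)) ≤ |β| * g :=
    (neg_le_abs _).trans (by rw [abs_mul]; exact mul_le_mul_of_nonneg_left hbk (abs_nonneg _))
  have h2 : δ * |b - k| ≤ |α| * g :=
    mul_le_mul hδα hbk (abs_nonneg _) (abs_nonneg _)
  have h6 : 0 ≤ |α| * g := by positivity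
  have hγα : γ ≤ α := hγ.trans (min_le_left _ _)
  have hγβ : γ ≤ β := hγ.trans (min_le_right _ _)
  rcases le_total 0 α with hα | hα
  · left
    have h3 : γ * k ≤ β * k := mul_le_mul_of_nonneg_right hγβ hk
    have h4 : δ * |a| ≤ α * a := by
      rw [abs_of_nonneg ha]; rw [abs_of_nonneg hα] at hδα
      exact mul_le_mul_of_nonneg_right hδα ha
    linarith
  · right
    have h3 : γ * k ≤ (α + β) * k := mul_le_mul_of_nonneg_right (by linarith) hk
    have h4 : δ * |a - k| ≤ α * (a - k) + 2 * (|α| * g) := by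
      rw [abs_of_nonpos hα] at hδα ⊢
      rcases le_total a k with h | h
      · rw [abs_of_nonpos (by linarith)]
        have := mul_le_mul_of_nonneg_right hδα (by linarith : 0 ≤ k - a)
        have := mul_nonneg (by linarith : 0 ≤ -α) hg
        linarith
      · rw [abs_of_nonneg (by linarith)]
        have := mul_le_mul_of_nonneg_right hδα (by linarith : 0 ≤ a - k)
        have := mul_le_mul_of_nonneg_left (by linarith : a - k ≤ g) (by linarith : 0 ≤ -α)
        linarith
    linarith

lemma exp_to_w {α β γ δ E x y : ℝ} {a b k : ℕ}
    (h : -α * a + -β * b ≤ E + -γ * k + (-δ * |x| + -δ * |y|)) :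
    w α a * w β b ≤ (2:ℝ) ^ E * w γ k * (ee δ x * ee δ y) := by
  unfold w ee
  simp only [← Real.rpow_add (by norm_num : (0:ℝ) < 2)]
  exact Real.rpow_le_rpow_of_exponent_le (by norm_num) h

lemma nat_abs_sub_le {a b g : ℕ} (h1 : a ≤ b + g) (h2 : b ≤ a + g) : |(a:ℝ) - b| ≤ g := by
  have h1' : (a:ℝ) ≤ b + g := by exact_mod_cast h1
  have h2' : (b:ℝ) ≤ a + g := by exact_mod_cast h2
  rw [abs_le]; constructor <;> linarith

/-- Resonant summation. -/
lemma res_sum {α β γ : ℝ} (hγ : γ ≤ α + β) (hab : 0 < α + β) :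
    ∃ C : ℝ, 0 < C ∧ ∀ (k : ℕ) (S : Finset (ℕ × ℕ)),
      (∀ q ∈ S, q.1 ≤ q.2 + 13 ∧ q.2 ≤ q.1 + 13 ∧ k ≤ q.1 + 13) →
      ∑ q ∈ S, w α q.1 * w β q.2 ≤ C * w γ k := by
  obtain ⟨D, hD, hsum⟩ := ee_sum hab
  set E := (|β| * 13 + 3 * ((α + β) * 13))
  refine ⟨(2:ℝ) ^ E * (D * D + 1), by positivity, fun k S hS => ?_⟩
  calc ∑ q ∈ S, w α q.1 * w β q.2
      ≤ ∑ q ∈ S, (2:ℝ) ^ E * w γ k * (ee (α + β) ((q.1:ℝ) - k) * ee (α + β) ((q.1:ℝ) - q.2)) := by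
        refine Finset.sum_le_sum fun q hq => ?_
        obtain ⟨h1, h2, h3⟩ := hS q hq
        apply exp_to_w
        exact res_exp hab le_rfl hγ (Nat.cast_nonneg _) (by exact_mod_cast nat_abs_sub_le h1 h2)
          (by exact_mod_cast h3)
    _ ≤ (2:ℝ) ^ E * w γ k * (D * D) := by
        rw [← Finset.mul_sum]
        refine mul_le_mul_of_nonneg_left ?_ (mul_nonneg (by positivity) (w_pos _ _).le)
        refine double_sum hD (u := fun a => ee (α + β) ((a:ℝ) - k))
          (v := fun a b => ee (α + β) ((a:ℝ) - b)) (fun _ => (ee_pos _ _).le)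
          (fun _ _ => (ee_pos _ _).le) (fun T => hsum T k) (fun a T => ?_) S
        simp only [ee_symm _ (a:ℝ)]
        exact hsum T a
    _ ≤ _ := by
        have : 0 < (2:ℝ) ^ E * w γ k := mul_pos (by positivity) (w_pos _ _)
        nlinarith

/-- Low-high summation. -/
lemma low_sum {α β γ : ℝ} (hα : α ≠ 0) (hγ : γ ≤ min α β) (hab : 0 < α + β) :
    ∃ C : ℝ, 0 < C ∧ ∀ (k : ℕ) (S : Finset (ℕ × ℕ)),
      (∀ q ∈ S, q.1 ≤ k + 13 ∧ q.2 ≤ k + 13 ∧ k ≤ q.2 + 13) →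
      ∑ q ∈ S, w α q.1 * w β q.2 ≤ C * w γ k := by
  have hδ : 0 < |α| := abs_pos.2 hα
  obtain ⟨D, hD, hsum⟩ := ee_sum hδ
  set E := ((|β| + 3 * |α|) * 13)
  refine ⟨(2:ℝ) ^ E * (2 * (D * D) + 1), by positivity, fun k S hS => ?_⟩
  have hd : ∀ c : ℕ, ∑ q ∈ S, ee |α| ((q.1:ℝ) - c) * ee |α| ((q.2:ℝ) - k) ≤ D * D := fun c =>
    double_sum hD (u := fun a => ee |α| ((a:ℝ) - c))
          (v := fun a b => ee |α| ((b:ℝ) - k)) (fun _ => (ee_pos _ _).le)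
          (fun _ _ => (ee_pos _ _).le) (fun T => hsum T c) (fun a T => hsum T k) S
  have h0 := hd 0
  have hk := hd k
  simp only [Nat.cast_zero, sub_zero] at h0
  have hp : 0 < (2:ℝ) ^ E * w γ k := mul_pos (by positivity) (w_pos _ _)
  calc ∑ q ∈ S, w α q.1 * w β q.2
      ≤ ∑ q ∈ S, (2:ℝ) ^ E * w γ k * (ee |α| (q.1:ℝ) * ee |α| ((q.2:ℝ) - k) +
          ee |α| ((q.1:ℝ) - k) * ee |α| ((q.2:ℝ) - k)) := by
        refine Finset.sum_le_sum fun q hq => ?_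
        obtain ⟨h1, h2, h3⟩ := hS q hq
        have p1 : 0 < ee |α| (q.1:ℝ) * ee |α| ((q.2:ℝ) - k) := mul_pos (ee_pos _ _) (ee_pos _ _)
        have p2 : 0 < ee |α| ((q.1:ℝ) - k) * ee |α| ((q.2:ℝ) - k) :=
          mul_pos (ee_pos _ _) (ee_pos _ _)
        rcases low_exp (g := 13) (a := q.1) (b := q.2) (k := k) hδ le_rfl hγ hab
          (Nat.cast_nonneg _) (Nat.cast_nonneg _) (by exact_mod_cast nat_abs_sub_le h2 h3)
          (by exact_mod_cast h1) with h | h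
        · refine (exp_to_w h).trans (mul_le_mul_of_nonneg_left (by linarith) hp.le)
        · refine (exp_to_w h).trans (mul_le_mul_of_nonneg_left (by linarith) hp.le)
    _ ≤ (2:ℝ) ^ E * w γ k * (2 * (D * D)) := by
        rw [← Finset.mul_sum, Finset.sum_add_distrib]
        exact mul_le_mul_of_nonneg_left (by linarith) hp.le
    _ ≤ _ := by nlinarith

lemma adm_sum {α β γ : ℝ} (hα : α ≠ 0) (hβ : β ≠ 0) (hγ : γ ≤ min α β) (hab : 0 < α + β) :
    ∃ C : ℝ, 0 < C ∧ ∀ (k : ℕ) (S : Finset (ℕ × ℕ)),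
      (∀ q ∈ S, Adm k q.1 q.2) → ∑ q ∈ S, w α q.1 * w β q.2 ≤ C * w γ k := by
  have hγ' : γ ≤ α + β := by
    rcases le_total α β with h | h
    · rw [min_eq_left h] at hγ; linarith
    · rw [min_eq_right h] at hγ; linarith
  obtain ⟨C1, hC1, h1⟩ := res_sum hγ' hab
  obtain ⟨C2, hC2, h2⟩ := low_sum hα hγ hab
  obtain ⟨C3, hC3, h3⟩ := low_sum (α := β) (β := α) (γ := γ) hβ (by rwa [min_comm]) (by linarith)
  refine ⟨C1 + C2 + C3, by positivity, fun k S hS => ?_⟩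
  have e := Finset.sum_filter_add_sum_filter_not S (fun q => q.1 + 3 < q.2)
    (fun q => w α q.1 * w β q.2)
  have e' := Finset.sum_filter_add_sum_filter_not (S.filter (fun q => ¬ q.1 + 3 < q.2))
    (fun q => q.2 + 3 < q.1) (fun q => w α q.1 * w β q.2)
  have b2 := h2 k (S.filter (fun q => q.1 + 3 < q.2)) (by
    intro q hq
    rw [Finset.mem_filter] at hq
    obtain ⟨hq, hlt⟩ := hq
    have := hS q hq
    unfold Adm at this
    omega)
  have b1 := h1 k ((S.filter (fun q => ¬ q.1 + 3 < q.2)).filter (fun q => ¬ q.2 + 3 < q.1)) (by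
    intro q hq
    rw [Finset.mem_filter, Finset.mem_filter] at hq
    obtain ⟨⟨hq, hlt⟩, hlt'⟩ := hq
    have := hS q hq
    unfold Adm at this
    omega)
  have b3 := h3 k (((S.filter (fun q => ¬ q.1 + 3 < q.2)).filter (fun q => q.2 + 3 < q.1)).map
    (Equiv.prodComm ℕ ℕ).toEmbedding) (by
    intro q hq
    rw [Finset.mem_map] at hq
    obtain ⟨q', hq', rfl⟩ := hq
    rw [Finset.mem_filter, Finset.mem_filter] at hq'
    obtain ⟨⟨hq, hlt⟩, hlt'⟩ := hq'
    have := hS q' hq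
    unfold Adm at this
    simp
    omega)
  rw [Finset.sum_map] at b3
  simp only [Equiv.coe_toEmbedding, Equiv.prodComm_apply, Prod.fst_swap, Prod.snd_swap,
    mul_comm (w β _)] at b3
  rw [← e, ← e']
  linarith

lemma LP_finsum {ρ : ℝ → ℝ} (hρ : IsLPCutoff ρ) (k : ℕ) {ι : Type*} (S : Finset ι)
    {f : ι → ℝ → ℝ} (hf : ∀ i, BC (f i)) (x : ℝ) :
    LP ρ k (fun y => ∑ i ∈ S, f i y) x = ∑ i ∈ S, LP ρ k (f i) x := by
  unfold LP
  rw [← integral_finsetSum]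
  · simp only [Finset.mul_sum]
  · intro i _
    exact BC.integrable_mul (lpKernel_int hρ k) ((hf i).comp (by fun_prop : Continuous fun y => x - y))

lemma LP_bound {ρ : ℝ → ℝ} (hρ : IsLPCutoff ρ) {C₀ : ℝ} (hC : ∀ k, ∫ y, |lpKernel ρ k y| ≤ C₀)
    (k : ℕ) {f : ℝ → ℝ} {B : ℝ} (hB : 0 ≤ B) (hf : ∀ x, |f x| ≤ B) (x : ℝ) :
    |LP ρ k f x| ≤ C₀ * B :=
  (abs_integral_le (lpKernel_int hρ k) (fun y => hf (x - y))).trans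
    (mul_le_mul_of_nonneg_right (hC k) hB)

/-- One-dimensional product estimate. -/
lemma LP_mul_bound {ρ : ℝ → ℝ} (hρ : IsLPCutoff ρ) {α β γ : ℝ} (hα : α ≠ 0) (hβ : β ≠ 0)
    (hγ : γ ≤ min α β) (hab : 0 < α + β) :
    ∃ C : ℝ, 0 < C ∧ ∀ (k : ℕ) (f g : ℝ → ℝ) (X Y : ℝ), BC f → BC g → 0 ≤ X → 0 ≤ Y →
      (∀ a x, |LP ρ a f x| ≤ X * w α a) → (∀ b x, |LP ρ b g x| ≤ Y * w β b) →
      ∀ x, |LP ρ k (fun y => f y * g y) x| ≤ C * X * Y * w γ k := by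
  obtain ⟨C₀, hC₀, hker⟩ := lpKernel_L1 hρ
  obtain ⟨C₁, hC₁, hadm⟩ := adm_sum hα hβ hγ hab
  set c := Real.sqrt (2 * Real.pi) with hc
  have hc0 : 0 < c := by positivity
  refine ⟨(c * c)⁻¹ * (C₀ * C₁), by positivity, ?_⟩
  intro k f g X Y hf hg hX hY hfa hgb x
  have hfin : ∀ n : ℕ, |LP ρ k (fun y => (∑ a ∈ Finset.range (n+1), LP ρ a f y) *
      (∑ b ∈ Finset.range (n+1), LP ρ b g y)) x| ≤ C₀ * C₁ * X * Y * w γ k := by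
    intro n
    simp only [Finset.sum_mul_sum, ← Finset.sum_product']
    rw [LP_finsum hρ k _ (f := fun q : ℕ × ℕ => fun y => LP ρ q.1 f y * LP ρ q.2 g y)
      (fun q => (LP_BC hρ _ hf).mul (LP_BC hρ _ hg))]
    refine (Finset.abs_sum_le_sum_abs _ _).trans ?_
    set S := Finset.range (n+1) ×ˢ Finset.range (n+1)
    calc ∑ q ∈ S, |LP ρ k (fun y => LP ρ q.1 f y * LP ρ q.2 g y) x|
        ≤ ∑ q ∈ S, if Adm k q.1 q.2 then C₀ * (X * Y) * (w α q.1 * w β q.2) else 0 := by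
          refine Finset.sum_le_sum fun q _ => ?_
          split_ifs with h
          · have hB : 0 ≤ (X * w α q.1) * (Y * w β q.2) :=
              mul_nonneg (mul_nonneg hX (w_pos _ _).le) (mul_nonneg hY (w_pos _ _).le)
            have := LP_bound hρ hker k (f := fun y => LP ρ q.1 f y * LP ρ q.2 g y) hB (fun y => by
              rw [abs_mul]
              exact mul_le_mul (hfa _ _) (hgb _ _) (abs_nonneg _)
                (mul_nonneg hX (w_pos _ _).le)) x
            linarith
          · rw [LP_triple_zero hρ hf hg (not_adm hρ h), abs_zero]
      _ = C₀ * (X * Y) * ∑ q ∈ S.filter (fun q => Adm k q.1 q.2), w α q.1 * w β q.2 := by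
          rw [Finset.mul_sum, Finset.sum_filter]
      _ ≤ C₀ * (X * Y) * (C₁ * w γ k) := by
          refine mul_le_mul_of_nonneg_left (hadm k _ fun q hq => (Finset.mem_filter.1 hq).2)
            (by positivity)
      _ = _ := by ring
  obtain ⟨D, hD, hDb⟩ := LP_sum_bound hρ hf
  obtain ⟨D', hD', hDb'⟩ := LP_sum_bound hρ hg
  have hlim : Filter.Tendsto (fun n : ℕ => LP ρ k (fun y => (∑ a ∈ Finset.range (n+1), LP ρ a f y) *
      (∑ b ∈ Finset.range (n+1), LP ρ b g y)) x) Filter.atTop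
      (nhds (∫ y, lpKernel ρ k y * ((c * f (x - y)) * (c * g (x - y))))) := by
    unfold LP
    refine tendsto_integral_of_dominated_convergence (fun y => |lpKernel ρ k y| * (D * D')) ?_
      ((lpKernel_int hρ k).abs.mul_const _) ?_ ?_
    · intro n
      have h1 : BC (fun y => ∑ a ∈ Finset.range (n+1), LP ρ a f y) :=
        BC.sum _ fun a => LP_BC hρ a hf
      have h2 : BC (fun y => ∑ a ∈ Finset.range (n+1), LP ρ a g y) :=
        BC.sum _ fun a => LP_BC hρ a hg
      exact (((h1.mul h2).comp (by fun_prop : Continuous fun y => x - y)).integrable_mul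
        (lpKernel_int hρ k)).aestronglyMeasurable
    · intro n
      filter_upwards with y
      rw [Real.norm_eq_abs, abs_mul, abs_mul]
      refine mul_le_mul_of_nonneg_left ?_ (abs_nonneg _)
      exact mul_le_mul (hDb n (x - y)) (hDb' n (x - y)) (abs_nonneg _) hD
    · filter_upwards with y
      exact ((LP_tendsto hρ hf (x - y)).mul (LP_tendsto hρ hg (x - y))).const_mul _
  have e : ∫ y, lpKernel ρ k y * ((c * f (x - y)) * (c * g (x - y))) =
      (c * c) * LP ρ k (fun y => f y * g y) x := by
    unfold LP
    rw [← integral_const_mul]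
    congr 1; ext y; ring
  rw [e] at hlim
  have hle := le_of_tendsto hlim.abs (Filter.Eventually.of_forall hfin)
  rw [abs_mul, abs_of_pos (by positivity : 0 < c * c)] at hle
  have : (c * c)⁻¹ * (C₀ * C₁) * X * Y * w γ k = (c * c)⁻¹ * (C₀ * C₁ * X * Y * w γ k) := by ring
  rw [this, le_inv_mul_iff₀ (by positivity)]
  exact hle

lemma w_mul_pow (α : ℝ) (k : ℕ) : w α k * ((2:ℝ) ^ k) ^ α = 1 := by
  unfold w
  rw [← Real.rpow_natCast, ← Real.rpow_mul (by norm_num), ← Real.rpow_add (by norm_num)]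
  have : -α * (k:ℝ) + k * α = 0 := by ring
  rw [this, Real.rpow_zero]

lemma hNorm2_bound {ρ : ℝ → ℝ} {α₁ α₂ : ℝ} {F : ℝ × ℝ → ℝ} (h : hNorm2 ρ α₁ α₂ F ≠ ∞)
    (k₁ k₂ : ℕ) (p : ℝ × ℝ) :
    |LPu ρ k₁ (LPv ρ k₂ F) p| ≤ (hNorm2 ρ α₁ α₂ F).toReal * w α₁ k₁ * w α₂ k₂ := by
  have h1 : ENNReal.ofReal (((2 : ℝ) ^ k₁) ^ α₁ * ((2 : ℝ) ^ k₂) ^ α₂) *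
      ENNReal.ofReal |LPu ρ k₁ (LPv ρ k₂ F) p| ≤ hNorm2 ρ α₁ α₂ F := by
    unfold hNorm2
    refine le_trans ?_ (le_iSup₂ k₁ k₂)
    exact mul_le_mul_right (le_iSup (fun p => ENNReal.ofReal |LPu ρ k₁ (LPv ρ k₂ F) p|) p) _
  rw [← ENNReal.ofReal_mul (by positivity), ENNReal.ofReal_le_iff_le_toReal h] at h1
  have e1 := w_mul_pow α₁ k₁
  have e2 := w_mul_pow α₂ k₂
  have hp : 0 < w α₁ k₁ * w α₂ k₂ := mul_pos (w_pos _ _) (w_pos _ _)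
  have := mul_le_mul_of_nonneg_left h1 hp.le
  calc |LPu ρ k₁ (LPv ρ k₂ F) p| = (w α₁ k₁ * ((2:ℝ) ^ k₁) ^ α₁) * (w α₂ k₂ * ((2:ℝ) ^ k₂) ^ α₂) *
        |LPu ρ k₁ (LPv ρ k₂ F) p| := by rw [e1, e2]; ring
    _ = w α₁ k₁ * w α₂ k₂ * (((2 : ℝ) ^ k₁) ^ α₁ * ((2 : ℝ) ^ k₂) ^ α₂ *
        |LPu ρ k₁ (LPv ρ k₂ F) p|) := by ring
    _ ≤ _ := this
    _ = _ := by ring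

lemma hNorm2_le {ρ : ℝ → ℝ} {γ₁ γ₂ : ℝ} {F : ℝ × ℝ → ℝ} {B : ℝ}
    (h : ∀ k₁ k₂ p, |LPu ρ k₁ (LPv ρ k₂ F) p| ≤ B * w γ₁ k₁ * w γ₂ k₂) :
    hNorm2 ρ γ₁ γ₂ F ≤ ENNReal.ofReal B := by
  unfold hNorm2
  refine iSup₂_le fun k₁ k₂ => ?_
  rw [ENNReal.mul_iSup]
  refine iSup_le fun p => ?_
  rw [← ENNReal.ofReal_mul (by positivity)]
  refine ENNReal.ofReal_le_ofReal ?_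
  have e1 := w_mul_pow γ₁ k₁
  have e2 := w_mul_pow γ₂ k₂
  calc ((2 : ℝ) ^ k₁) ^ γ₁ * ((2 : ℝ) ^ k₂) ^ γ₂ * |LPu ρ k₁ (LPv ρ k₂ F) p|
      ≤ ((2 : ℝ) ^ k₁) ^ γ₁ * ((2 : ℝ) ^ k₂) ^ γ₂ * (B * w γ₁ k₁ * w γ₂ k₂) :=
        mul_le_mul_of_nonneg_left (h k₁ k₂ p) (by positivity)
    _ = B * (w γ₁ k₁ * ((2:ℝ) ^ k₁) ^ γ₁) * (w γ₂ k₂ * ((2:ℝ) ^ k₂) ^ γ₂) := by ring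
    _ = B := by rw [e1, e2]; ring

lemma CbSmooth.bc {F : ℝ × ℝ → ℝ} (hF : CbSmooth F) : BC F := by
  obtain ⟨C, hC⟩ := hF.2 0
  refine ⟨hF.1.continuous, C, (norm_nonneg _).trans (hC 0), fun x => ?_⟩
  have := hC x
  rwa [norm_iteratedFDeriv_zero] at this

lemma DClose.nat {a b : ℕ} (h : DClose a b) : a ≤ b + 10 ∧ b ≤ a + 10 := by
  obtain ⟨h1, h2⟩ := h
  rw [div_lt_iff₀ (by positivity), ← pow_add] at h1
  rw [← pow_add] at h2
  rw [pow_lt_pow_iff_right₀ (by norm_num)] at h1 h2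
  omega

/-- If all pieces vanish then so do the one-variable projections. -/
lemma LPu_zero {ρ : ℝ → ℝ} (hρ : IsLPCutoff ρ) {α₁ α₂ : ℝ} {F : ℝ × ℝ → ℝ} (hF : BC F)
    (h : hNorm2 ρ α₁ α₂ F = 0) (k : ℕ) (p : ℝ × ℝ) : LPu ρ k F p = 0 := by
  have hz : ∀ l q, LPv ρ l (LPu ρ k F) q = 0 := by
    intro l q
    rw [← LPu_LPv hρ k l hF]
    have := hNorm2_bound (ρ := ρ) (F := F) (α₁ := α₁) (α₂ := α₂) (by simp [h]) k l q
    rw [h] at this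
    simpa using this
  have hb : BC (fun v => LPu ρ k F (p.1, v)) := (LPu_BC hρ k hF).comp (by fun_prop)
  have ht := LP_tendsto hρ hb p.2
  have hz' : ∀ l, LP ρ l (fun v => LPu ρ k F (p.1, v)) p.2 = 0 := fun l => hz l p
  simp only [hz', Finset.sum_const_zero] at ht
  have h0 := tendsto_nhds_unique ht tendsto_const_nhds
  have : Real.sqrt (2 * Real.pi) ≠ 0 := by positivity
  exact (mul_eq_zero.1 h0).resolve_left this

lemma main_real {ρ : ℝ → ℝ} (hρ : IsLPCutoff ρ) {α₁ α₂ β₁ β₂ γ₁ γ₂ : ℝ}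
    (hα₂ : α₂ ≠ 0) (hβ₂ : β₂ ≠ 0) (hγ₁ : γ₁ ≤ α₁ + β₁) (hab₁ : 0 < α₁ + β₁)
    (hγ₂ : γ₂ ≤ min α₂ β₂) (hab₂ : 0 < α₂ + β₂) :
    ∃ C : ℝ, 0 < C ∧ ∀ F G : ℝ × ℝ → ℝ, BC F → BC G → ∀ S : Finset (ℕ × ℕ),
      (∀ q ∈ S, DClose q.1 q.2) → ∀ X Y : ℝ, 0 ≤ X → 0 ≤ Y →
      (∀ k₁ k₂ p, |LPu ρ k₁ (LPv ρ k₂ F) p| ≤ X * w α₁ k₁ * w α₂ k₂) →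
      (∀ k₁ k₂ p, |LPu ρ k₁ (LPv ρ k₂ G) p| ≤ Y * w β₁ k₁ * w β₂ k₂) →
      ∀ k₁ k₂ p, |LPu ρ k₁ (LPv ρ k₂ (fun p => ∑ q ∈ S, LPu ρ q.1 F p * LPu ρ q.2 G p)) p| ≤
        (C * X * Y) * w γ₁ k₁ * w γ₂ k₂ := by
  obtain ⟨C₀, hC₀, hker⟩ := lpKernel_L1 hρ
  obtain ⟨C₁, hC₁, hres⟩ := res_sum hγ₁ hab₁
  obtain ⟨C₂, hC₂, hprod⟩ := LP_mul_bound hρ hα₂ hβ₂ hγ₂ hab₂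
  refine ⟨C₀ * C₁ * C₂, by positivity, ?_⟩
  intro F G hF hG S hS X Y hX hY hFX hGY k₁ k₂ p
  have hFG : ∀ q : ℕ × ℕ, BC (fun p => LPu ρ q.1 F p * LPu ρ q.2 G p) := fun q =>
    (LPu_BC hρ _ hF).mul (LPu_BC hρ _ hG)
  have e1 : LPv ρ k₂ (fun p => ∑ q ∈ S, LPu ρ q.1 F p * LPu ρ q.2 G p) =
      fun p => ∑ q ∈ S, LPv ρ k₂ (fun p => LPu ρ q.1 F p * LPu ρ q.2 G p) p := by
    ext p
    exact LP_finsum hρ k₂ S (f := fun q v => LPu ρ q.1 F (p.1, v) * LPu ρ q.2 G (p.1, v))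
      (fun q => (hFG q).comp (by fun_prop)) p.2
  have e2 : LPu ρ k₁ (LPv ρ k₂ (fun p => ∑ q ∈ S, LPu ρ q.1 F p * LPu ρ q.2 G p)) p =
      ∑ q ∈ S, LPu ρ k₁ (LPv ρ k₂ (fun p => LPu ρ q.1 F p * LPu ρ q.2 G p)) p := by
    rw [e1]
    exact LP_finsum hρ k₁ S
      (f := fun q u => LPv ρ k₂ (fun p => LPu ρ q.1 F p * LPu ρ q.2 G p) (u, p.2))
      (fun q => (LPv_BC hρ k₂ (hFG q)).comp (by fun_prop)) p.1
  rw [e2]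
  refine (Finset.abs_sum_le_sum_abs _ _).trans ?_
  have hw : 0 < w γ₂ k₂ := w_pos _ _
  calc ∑ q ∈ S, |LPu ρ k₁ (LPv ρ k₂ (fun p => LPu ρ q.1 F p * LPu ρ q.2 G p)) p|
      ≤ ∑ q ∈ S, if Adm k₁ q.1 q.2 then
          (C₀ * C₂ * X * Y * w γ₂ k₂) * (w α₁ q.1 * w β₁ q.2) else 0 := by
        refine Finset.sum_le_sum fun q _ => ?_
        split_ifs with h
        · have p1 : 0 ≤ X * w α₁ q.1 := mul_nonneg hX (w_pos _ _).le
          have p2 : 0 ≤ Y * w β₁ q.2 := mul_nonneg hY (w_pos _ _).le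
          have hB : 0 ≤ C₂ * (X * w α₁ q.1) * (Y * w β₁ q.2) * w γ₂ k₂ := by positivity
          have := LP_bound hρ hker k₁
            (f := fun u => LPv ρ k₂ (fun p => LPu ρ q.1 F p * LPu ρ q.2 G p) (u, p.2)) hB
            (fun u => hprod k₂ (fun v => LPu ρ q.1 F (u, v)) (fun v => LPu ρ q.2 G (u, v)) _ _
              ((LPu_BC hρ _ hF).comp (by fun_prop)) ((LPu_BC hρ _ hG).comp (by fun_prop)) p1 p2
              (fun a v => by
                have := hFX q.1 a (u, v)
                rw [LPu_LPv hρ _ _ hF] at this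
                exact this)
              (fun a v => by
                have := hGY q.2 a (u, v)
                rw [LPu_LPv hρ _ _ hG] at this
                exact this) p.2) p.1
          refine this.trans (le_of_eq (by ring))
        · rw [LPu_LPv hρ _ _ (hFG q)]
          have hz : ∀ r, LPu ρ k₁ (fun p => LPu ρ q.1 F p * LPu ρ q.2 G p) r = 0 := fun r =>
            LP_triple_zero hρ (f := fun u => F (u, r.2)) (g := fun u => G (u, r.2))
              (hF.comp (by fun_prop)) (hG.comp (by fun_prop)) (not_adm hρ h) r.1
          have : LPu ρ k₁ (fun p => LPu ρ q.1 F p * LPu ρ q.2 G p) = fun _ => 0 := funext hz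
          rw [this]
          simp [LPv]
    _ = (C₀ * C₂ * X * Y * w γ₂ k₂) *
          ∑ q ∈ S.filter (fun q => Adm k₁ q.1 q.2), w α₁ q.1 * w β₁ q.2 := by
        rw [Finset.mul_sum, Finset.sum_filter]
    _ ≤ (C₀ * C₂ * X * Y * w γ₂ k₂) * (C₁ * w γ₁ k₁) := by
        refine mul_le_mul_of_nonneg_left (hres k₁ _ fun q hq => ?_) (by positivity)
        obtain ⟨hq, ha⟩ := Finset.mem_filter.1 hq
        have := DClose.nat (hS q hq)
        unfold Adm at ha
        omega
    _ = _ := by ring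

end BPR

/-- **Proposition 2.6(iv): resonant improvement of the bilinear paraproduct estimate.**
For `γ₁ ≤ α₁ + β₁`, `α₁ + β₁ > 0`, `γ₂ ≤ min (α₂, β₂)` and `α₂ + β₂ > 0`, the resonant
paraproduct `Σ_{(M,N)∈S, M ∼ N} P_M^u F · P_N^u G` obeys the bilinear estimate. -/
theorem bilinear_paraproduct_resonant
    (ρ : ℝ → ℝ) (hρ : IsLPCutoff ρ)
    (α₁ α₂ β₁ β₂ γ₁ γ₂ : ℝ)
    (hα₁ : α₁ ≠ 0) (hα₂ : α₂ ≠ 0) (hβ₁ : β₁ ≠ 0) (hβ₂ : β₂ ≠ 0)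
    (hγ₁ : γ₁ ≤ α₁ + β₁) (hab₁ : 0 < α₁ + β₁)
    (hγ₂ : γ₂ ≤ min α₂ β₂) (hab₂ : 0 < α₂ + β₂) :
    ∃ C : ℝ≥0∞, C ≠ ∞ ∧ ∀ F G : ℝ × ℝ → ℝ, CbSmooth F → CbSmooth G →
      ∀ S : Finset (ℕ × ℕ),
        (∀ q ∈ S, DClose q.1 q.2) →
        hNorm2 ρ γ₁ γ₂ (fun p => ∑ q ∈ S, LPu ρ q.1 F p * LPu ρ q.2 G p) ≤
          C * hNorm2 ρ α₁ α₂ F * hNorm2 ρ β₁ β₂ G := by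
  obtain ⟨C, hC, hmain⟩ := BPR.main_real hρ (α₁ := α₁) (β₁ := β₁) hα₂ hβ₂ hγ₁ hab₁ hγ₂ hab₂
  refine ⟨ENNReal.ofReal C, ENNReal.ofReal_ne_top, ?_⟩
  intro F G hF hG S hS
  have hF' := BPR.CbSmooth.bc hF
  have hG' := BPR.CbSmooth.bc hG
  have hC0 : ENNReal.ofReal C ≠ 0 := by simpa using hC
  have zero_case : (∀ q ∈ S, ∀ p, LPu ρ q.1 F p * LPu ρ q.2 G p = 0) →
      hNorm2 ρ γ₁ γ₂ (fun p => ∑ q ∈ S, LPu ρ q.1 F p * LPu ρ q.2 G p) ≤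
          ENNReal.ofReal C * hNorm2 ρ α₁ α₂ F * hNorm2 ρ β₁ β₂ G := by
    intro h
    have e : (fun p => ∑ q ∈ S, LPu ρ q.1 F p * LPu ρ q.2 G p) = fun _ => 0 := by
      ext p
      exact Finset.sum_eq_zero fun q hq => h q hq p
    rw [e]
    have := BPR.hNorm2_le (ρ := ρ) (γ₁ := γ₁) (γ₂ := γ₂) (F := fun _ => 0) (B := 0)
      (by intro k₁ k₂ p; simp [LPu, LPv])
    rw [ENNReal.ofReal_zero] at this
    exact this.trans zero_le
  by_cases hA0 : hNorm2 ρ α₁ α₂ F = 0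
  · exact zero_case fun q _ p => by rw [BPR.LPu_zero hρ hF' hA0, zero_mul]
  by_cases hB0 : hNorm2 ρ β₁ β₂ G = 0
  · exact zero_case fun q _ p => by rw [BPR.LPu_zero hρ hG' hB0, mul_zero]
  by_cases hA : hNorm2 ρ α₁ α₂ F = ∞
  · rw [hA, ENNReal.mul_top hC0, ENNReal.top_mul hB0]; exact le_top
  by_cases hB : hNorm2 ρ β₁ β₂ G = ∞
  · rw [hB, ENNReal.mul_top (mul_ne_zero hC0 hA0)]; exact le_top
  have := BPR.hNorm2_le (hmain F G hF' hG' S hS _ _ ENNReal.toReal_nonneg ENNReal.toReal_nonneg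
    (BPR.hNorm2_bound hA) (BPR.hNorm2_bound hB))
  rwa [ENNReal.ofReal_mul (by positivity), ENNReal.ofReal_mul hC.le, ENNReal.ofReal_toReal hA,
    ENNReal.ofReal_toReal hB] at this
end
end
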